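/- (One-sided FDTM stability with respect to the domain.) Let K ⊂ ℝ^d be a compact convex set, μ a probability measure with supp(μ) ⊂ K, and F, G ⊂ K closed nonempty sets such that sup_{z ∈ F} dist(z, G) ≤ diam(K)/(25β). Then for all x, y ∈ K, D_{μ,G}(x,y) ≤ D_{μ,F}(x,y) + 10·√β·λ·diam(K)^{β+1/2}·√(sup_{z ∈ F} dist(z, G)), where λ = 2c·ρ^{β+1}/(ρ − 1) with c = (16·5^β + 1152·165^β)/m^{2+β} and ρ = 1 + 32/m. -/

import Mathlib

open MeasureTheory Metric Set ProbabilityTheory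
open scoped ENNReal NNReal

noncomputable section

/-- Euclidean space `ℝ^d`. -/
abbrev Euc (d : ℕ) := EuclideanSpace ℝ (Fin d)

/-- The pseudo-distance-to-measure `δ_{μ,u}(x) = inf {r > 0 : μ(B(x,r)) > u}`. -/
def pseudoDTM {d : ℕ} (μ : Measure (Euc d)) (u : ℝ) (x : Euc d) : ℝ :=
  sInf {r : ℝ | 0 < r ∧ u < (μ (ball x r)).toReal}

/-- The distance-to-measure `d_μ(x) = ((1/m) ∫₀^m δ_{μ,u}(x)^p du)^{1/p}`. -/
def dtm {d : ℕ} (m p : ℝ) (μ : Measure (Euc d)) (x : Euc d) : ℝ :=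
  ((1 / m) * ∫ u in Ioc (0 : ℝ) m, pseudoDTM μ u x ^ p) ^ (1 / p)

/-- A Lipschitz path. -/
def IsLipschitzPath {d : ℕ} (γ : ℝ → Euc d) : Prop := ∃ K, LipschitzWith K γ

/-- Euclidean length `|γ| = ∫₀¹ ‖γ'(t)‖ dt`. -/
def eucLength {d : ℕ} (γ : ℝ → Euc d) : ℝ := ∫ t in Icc (0 : ℝ) 1, ‖deriv γ t‖

/-- FDTM length `D_μ(γ) = ∫₀¹ d_μ(γ(t))^β ‖γ'(t)‖ dt`. -/
def fdtmLength {d : ℕ} (m p β : ℝ) (μ : Measure (Euc d)) (γ : ℝ → Euc d) : ℝ :=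
  ∫ t in Icc (0 : ℝ) 1, dtm m p μ (γ t) ^ β * ‖deriv γ t‖

/-- Admissible paths `Γ_F(x,y)`: Lipschitz paths from `x` to `y` which may leave the domain `F`
only along straight lines. -/
def AdmissiblePath {d : ℕ} (F : Set (Euc d)) (x y : Euc d) (γ : ℝ → Euc d) : Prop :=
  IsLipschitzPath γ ∧ γ 0 = x ∧ γ 1 = y ∧
    ∀ a b : ℝ, 0 ≤ a → b ≤ 1 →
      (∀ t ∈ Ioo a b, γ t ∉ F) →
      ∃ u : Euc d, ‖u‖ = 1 ∧
        ∀ᵐ t ∂(volume.restrict (Ioo a b)), deriv γ t = ‖deriv γ t‖ • u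

/-- The Fermat distance-to-measure `D_{μ,F}(x,y) = inf_{γ ∈ Γ_F(x,y)} D_μ(γ)`. -/
def fdtm {d : ℕ} (m p β : ℝ) (μ : Measure (Euc d)) (F : Set (Euc d)) (x y : Euc d) : ℝ :=
  sInf {L : ℝ | ∃ γ : ℝ → Euc d, AdmissiblePath F x y γ ∧ L = fdtmLength m p β μ γ}

/-- A geodesic: an admissible path realizing the FDTM. -/
def IsGeodesic {d : ℕ} (m p β : ℝ) (μ : Measure (Euc d)) (F : Set (Euc d)) (x y : Euc d)
    (γ : ℝ → Euc d) : Prop :=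
  AdmissiblePath F x y γ ∧ fdtmLength m p β μ γ = fdtm m p β μ F x y

/-- FDTM length of the straight segment `[x,y]`. -/
def segFDTM {d : ℕ} (m p β : ℝ) (μ : Measure (Euc d)) (x y : Euc d) : ℝ :=
  ‖x - y‖ * ∫ t in Icc (0 : ℝ) 1, dtm m p μ ((1 - t) • x + t • y) ^ β

/-- The explicit constant `λ = 2·c·ρ^{β+1}/(ρ−1)` with `c = (16·5^β + 1152·165^β)/m^{2+β}`
and `ρ = 1 + 32/m`. -/
def fdtmConst (m β : ℝ) : ℝ :=
  2 * ((16 * (5 : ℝ) ^ β + 1152 * (165 : ℝ) ^ β) / m ^ (2 + β)) * (1 + 32 / m) ^ (β + 1) /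
    ((1 + 32 / m) - 1)

/-- Support of a measure: points all of whose neighborhoods have positive mass. -/
def measSupport {d : ℕ} (μ : Measure (Euc d)) : Set (Euc d) :=
  {x | ∀ r : ℝ, 0 < r → 0 < μ (ball x r)}

/-- `(a,b)`-standard measure: `μ(B(x,r)) ≥ a·r^b` for `x ∈ supp(μ)` and `0 < r ≤ a^{-1/b}`. -/
def IsStandard {d : ℕ} (μ : Measure (Euc d)) (a b : ℝ) : Prop :=
  ∀ x ∈ measSupport μ, ∀ r : ℝ, 0 < r → r ≤ a ^ (-(1 / b)) → a * r ^ b ≤ (μ (ball x r)).toReal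

section DTM

variable {d : ℕ} {μ : Measure (Euc d)}

lemma pseudoDTM_nonneg (u : ℝ) (x : Euc d) : 0 ≤ pseudoDTM μ u x :=
  Real.sInf_nonneg fun _ hr => hr.1.le

lemma pseudoDTM_le {u r : ℝ} {x : Euc d} (hr : 0 < r) (h : u < (μ (ball x r)).toReal) :
    pseudoDTM μ u x ≤ r :=
  csInf_le ⟨0, fun _ hr => hr.1.le⟩ ⟨hr, h⟩

variable [IsProbabilityMeasure μ]

lemma exists_lt_measure_ball {u : ℝ} (hu : u < 1) (x : Euc d) :
    ∃ r : ℝ, 0 < r ∧ u < (μ (ball x r)).toReal := by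
  have h1 : Filter.Tendsto (fun n : ℕ => (μ (ball x (n : ℝ))).toReal) Filter.atTop (nhds 1) := by
    have h2 := tendsto_measure_iUnion_atTop (μ := μ) (s := fun n : ℕ => ball x (n : ℝ))
      (fun a b hab => ball_subset_ball (by exact_mod_cast hab))
    rw [iUnion_ball_nat, measure_univ] at h2
    exact (ENNReal.tendsto_toReal ENNReal.one_ne_top).comp h2
  obtain ⟨n, hn, hn0⟩ := ((h1.eventually (lt_mem_nhds hu)).and
    (Filter.eventually_gt_atTop 0)).exists
  exact ⟨n, by exact_mod_cast hn0, hn⟩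

lemma le_pseudoDTM {u r : ℝ} {x : Euc d} (hu : u < 1) (h : (μ (ball x r)).toReal ≤ u) :
    r ≤ pseudoDTM μ u x := by
  refine le_csInf (exists_lt_measure_ball hu x) fun s hs => ?_
  by_contra! hsr
  have : (μ (ball x s)).toReal ≤ (μ (ball x r)).toReal :=
    ENNReal.toReal_mono (measure_ne_top _ _) (measure_mono (ball_subset_ball hsr.le))
  linarith [hs.2]

lemma pseudoDTM_mono {u v : ℝ} (x : Euc d) (huv : u ≤ v) (hv : v < 1) :
    pseudoDTM μ u x ≤ pseudoDTM μ v x :=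
  le_csInf (exists_lt_measure_ball hv x) fun _ hs => pseudoDTM_le hs.1 (huv.trans_lt hs.2)

lemma pseudoDTM_le_add_dist {u : ℝ} (hu : u < 1) (x y : Euc d) :
    pseudoDTM μ u x ≤ pseudoDTM μ u y + dist x y := by
  rw [← sub_le_iff_le_add]
  refine le_csInf (exists_lt_measure_ball hu y) fun s hs => ?_
  rw [sub_le_iff_le_add]
  refine pseudoDTM_le (add_pos_of_pos_of_nonneg hs.1 dist_nonneg) (hs.2.trans_le ?_)
  refine ENNReal.toReal_mono (measure_ne_top _ _) (measure_mono ?_)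
  intro z hz
  rw [mem_ball] at hz ⊢
  linarith [dist_triangle z y x, dist_comm x y]

/-- The uniform probability measure on `(0, m]`. -/
def levelMeasure (m : ℝ) : Measure ℝ := ENNReal.ofReal (1 / m) • volume.restrict (Ioc 0 m)

lemma isProbabilityMeasure_levelMeasure {m : ℝ} (hm : 0 < m) :
    IsProbabilityMeasure (levelMeasure m) := by
  constructor
  simp only [levelMeasure, Measure.smul_apply, Measure.restrict_apply MeasurableSet.univ,
    univ_inter, Real.volume_Ioc, sub_zero, smul_eq_mul]
  rw [← ENNReal.ofReal_mul (by positivity)]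
  simp [hm.ne']

lemma ae_levelMeasure (m : ℝ) : ∀ᵐ u ∂(levelMeasure m), u ∈ Ioc 0 m := by
  have : ∀ᵐ u ∂(volume.restrict (Ioc 0 m)), u ∈ Ioc 0 m := ae_restrict_mem measurableSet_Ioc
  exact Measure.ae_smul_measure this _

lemma aestronglyMeasurable_pseudoDTM {m : ℝ} (hm : m < 1) (x : Euc d) :
    AEStronglyMeasurable (fun u => pseudoDTM μ u x) (levelMeasure m) := by
  have : AEMeasurable (fun u => pseudoDTM μ u x) (volume.restrict (Ioc 0 m)) :=
    aemeasurable_restrict_of_monotoneOn measurableSet_Ioc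
      fun a _ b hb hab => pseudoDTM_mono x hab (hb.2.trans_lt hm)
  exact (this.smul_measure _).aestronglyMeasurable

lemma memLp_pseudoDTM {m : ℝ} (hm0 : 0 < m) (hm : m < 1) (x : Euc d) (q : ℝ≥0∞) :
    MemLp (fun u => pseudoDTM μ u x) q (levelMeasure m) := by
  have := isProbabilityMeasure_levelMeasure hm0
  refine MemLp.of_bound (aestronglyMeasurable_pseudoDTM hm x) (pseudoDTM μ m x) ?_
  filter_upwards [ae_levelMeasure m] with u hu
  rw [Real.norm_of_nonneg (pseudoDTM_nonneg _ _)]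
  exact pseudoDTM_mono x hu.2 hm

lemma dtm_eq_lpNorm {m p : ℝ} (hm0 : 0 < m) (hm : m < 1) (hp : 1 ≤ p) (x : Euc d) :
    dtm m p μ x = lpNorm (fun u => pseudoDTM μ u x) (ENNReal.ofReal p) (levelMeasure m) := by
  have hp0 : 0 < p := by linarith
  rw [lpNorm_eq_integral_norm_rpow_toReal (by simpa using hp0) ENNReal.ofReal_ne_top
    (aestronglyMeasurable_pseudoDTM hm x), ENNReal.toReal_ofReal hp0.le, levelMeasure,
    integral_smul_measure, ENNReal.toReal_ofReal (by positivity), dtm, one_div p]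
  simp only [Real.norm_of_nonneg (pseudoDTM_nonneg _ _), smul_eq_mul]

lemma dtm_nonneg {m p : ℝ} (hm0 : 0 < m) (hm : m < 1) (hp : 1 ≤ p) (x : Euc d) :
    0 ≤ dtm m p μ x := by
  rw [dtm_eq_lpNorm hm0 hm hp]
  exact lpNorm_nonneg

lemma one_le_ofReal {p : ℝ} (hp : 1 ≤ p) : 1 ≤ ENNReal.ofReal p := by
  simpa using ENNReal.ofReal_le_ofReal hp

lemma dtm_le_add_of_forall {m p : ℝ} (hm0 : 0 < m) (hm : m < 1) (hp : 1 ≤ p) (x : Euc d)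
    {g : ℝ → ℝ} (hg : MemLp g (ENNReal.ofReal p) (levelMeasure m)) {c : ℝ} (hc : 0 ≤ c)
    (h : ∀ u ∈ Ioc 0 m, pseudoDTM μ u x ≤ g u + c) :
    dtm m p μ x ≤ lpNorm g (ENNReal.ofReal p) (levelMeasure m) + c := by
  have := isProbabilityMeasure_levelMeasure hm0
  have h1 := one_le_ofReal hp
  rw [dtm_eq_lpNorm hm0 hm hp]
  calc _ ≤ lpNorm (g + fun _ => c) (ENNReal.ofReal p) (levelMeasure m) := by
        rw [← toReal_eLpNorm (aestronglyMeasurable_pseudoDTM hm x),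
          ← toReal_eLpNorm (hg.1.add aestronglyMeasurable_const)]
        refine ENNReal.toReal_mono (hg.add (memLp_const c)).2.ne (eLpNorm_mono_ae ?_)
        filter_upwards [ae_levelMeasure m] with u hu
        rw [Real.norm_of_nonneg (pseudoDTM_nonneg _ _)]
        exact (h u hu).trans (le_abs_self _)
    _ ≤ _ := lpNorm_add_le hg h1
    _ = _ := by
        rw [lpNorm_const (by positivity) (IsProbabilityMeasure.ne_zero _)]
        simp [abs_of_nonneg hc]

lemma dtm_lipschitz {m p : ℝ} (hm0 : 0 < m) (hm : m < 1) (hp : 1 ≤ p) :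
    LipschitzWith 1 (dtm m p μ : Euc d → ℝ) := by
  refine LipschitzWith.of_le_add fun x y => ?_
  rw [dtm_eq_lpNorm hm0 hm hp y]
  exact dtm_le_add_of_forall hm0 hm hp x (memLp_pseudoDTM hm0 hm y _) dist_nonneg
    fun u hu => pseudoDTM_le_add_dist (hu.2.trans_lt hm) x y

lemma measure_eq_one_of_measSupport_subset {K : Set (Euc d)} (hK : measSupport μ ⊆ K) :
    (μ K) = 1 := by
  have h : μ.support ⊆ K := fun x hx => hK fun r hr =>
    (Measure.mem_support_iff_forall x).1 hx _ (ball_mem_nhds x hr)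
  have h2 : μ Kᶜ = 0 := measure_mono_null (compl_subset_compl.2 h) Measure.measure_compl_support
  have h3 : K ∈ ae μ := by simpa [mem_ae_iff] using h2
  rw [measure_congr (Filter.eventuallyEq_univ.2 h3), measure_univ]

lemma dtm_le_diam {m p : ℝ} (hm0 : 0 < m) (hm : m < 1) (hp : 1 ≤ p) {K : Set (Euc d)}
    (hKb : Bornology.IsBounded K) (hK : measSupport μ ⊆ K) {x : Euc d} (hx : x ∈ K) :
    dtm m p μ x ≤ diam K := by
  have h0 := dtm_le_add_of_forall (μ := μ) hm0 hm hp x (g := 0) (MemLp.zero)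
    (diam_nonneg (s := K)) ?_
  · simpa using h0
  intro u hu
  simp only [Pi.zero_apply, zero_add]
  refine le_of_forall_gt_imp_ge_of_dense fun r hr => ?_
  refine pseudoDTM_le (diam_nonneg.trans_lt hr) ?_
  have : μ (ball x r) = 1 := by
    refine le_antisymm prob_le_one ?_
    rw [← measure_eq_one_of_measSupport_subset hK]
    exact measure_mono fun z hz => mem_ball.2 ((dist_le_diam_of_mem hKb hz hx).trans_lt hr)
  rw [this]
  simpa using hu.2.trans_lt hm

lemma half_le_dtm {m p : ℝ} (hm0 : 0 < m) (hm : m < 1) (hp : 1 ≤ p) {x : Euc d} {r : ℝ}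
    (h : (μ (ball x r)).toReal ≤ m / 2) : r / 2 ≤ dtm m p μ x := by
  have := isProbabilityMeasure_levelMeasure hm0
  have hmem := memLp_pseudoDTM (μ := μ) hm0 hm x 1
  have h1 : ∫ u, pseudoDTM μ u x ∂(levelMeasure m) ≤ dtm m p μ x := by
    rw [dtm_eq_lpNorm hm0 hm hp]
    have h2 := lpNorm_one_eq_integral_norm (aestronglyMeasurable_pseudoDTM (μ := μ) hm x)
    simp only [Real.norm_of_nonneg (pseudoDTM_nonneg _ _)] at h2
    rw [← h2, ← toReal_eLpNorm (aestronglyMeasurable_pseudoDTM hm x),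
      ← toReal_eLpNorm (aestronglyMeasurable_pseudoDTM hm x)]
    exact ENNReal.toReal_mono (memLp_pseudoDTM hm0 hm x _).2.ne
      (eLpNorm_le_eLpNorm_of_exponent_le (one_le_ofReal hp) (aestronglyMeasurable_pseudoDTM hm x))
  refine le_trans ?_ h1
  have h3 : ∫ u, (Ioc (m / 2) m).indicator (fun _ => r) u ∂(levelMeasure m) = r / 2 := by
    rw [integral_indicator measurableSet_Ioc, setIntegral_const, levelMeasure, measureReal_def,
      Measure.smul_apply, Measure.restrict_apply measurableSet_Ioc,
      inter_eq_left.2 (Ioc_subset_Ioc_left (by positivity)), Real.volume_Ioc, smul_eq_mul,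
      smul_eq_mul, ENNReal.toReal_mul, ENNReal.toReal_ofReal (by positivity),
      ENNReal.toReal_ofReal (by linarith)]
    field_simp
    ring
  rw [← h3]
  refine integral_mono_ae ((integrable_const r).indicator measurableSet_Ioc)
    (memLp_one_iff_integrable.1 hmem) ?_
  filter_upwards [ae_levelMeasure m] with u hu
  by_cases hu2 : u ∈ Ioc (m / 2) m
  · rw [indicator_of_mem hu2]
    exact le_pseudoDTM (hu.2.trans_lt hm) (h.trans hu2.1.le)
  · rw [indicator_of_notMem hu2]
    exact pseudoDTM_nonneg _ _

/-- Points with small distance-to-measure cannot be numerous and far apart. -/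
lemma card_mul_lt_of_dtm_lt {m p : ℝ} (hm0 : 0 < m) (hm : m < 1) (hp : 1 ≤ p) {ι : Type*}
    (s : Finset ι) (hs : s.Nonempty) (z : ι → Euc d) {r : ℝ}
    (hsep : ∀ i ∈ s, ∀ j ∈ s, i ≠ j → 2 * r ≤ dist (z i) (z j))
    (hz : ∀ i ∈ s, dtm m p μ (z i) < r / 2) : (s.card : ℝ) * (m / 2) < 1 := by
  have h1 : ∀ i ∈ s, m / 2 < μ.real (ball (z i) r) := fun i hi => by
    by_contra! hcon
    exact absurd (half_le_dtm hm0 hm hp hcon) (not_le.2 (hz i hi))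
  have hdisj : PairwiseDisjoint (s : Set ι) fun i => ball (z i) r := fun i hi j hj hij =>
    ball_disjoint_ball (by linarith [hsep i hi j hj hij])
  calc (s.card : ℝ) * (m / 2) = ∑ i ∈ s, m / 2 := by simp
    _ < ∑ i ∈ s, μ.real (ball (z i) r) := Finset.sum_lt_sum_of_nonempty hs h1
    _ = μ.real (⋃ i ∈ s, ball (z i) r) :=
        (measureReal_biUnion_finset hdisj fun i _ => measurableSet_ball).symm
    _ ≤ 1 := measureReal_le_one

end DTM

section Chains

variable {d : ℕ} {f : Euc d → ℝ} {β m : ℝ}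

/-- The `f ^ β`-weighted length of the segment from `x` to `y`. -/
def segCost (f : Euc d → ℝ) (β : ℝ) (x y : Euc d) : ℝ :=
  dist x y * ∫ t in (0 : ℝ)..1, f (x + t • (y - x)) ^ β

/-- Points of low `f`-value cannot be numerous and far apart. -/
def PackingBound (f : Euc d → ℝ) (m : ℝ) : Prop :=
  ∀ (s : Finset ℕ) (z : ℕ → Euc d) (r : ℝ), s.Nonempty →
    (∀ i ∈ s, ∀ j ∈ s, i ≠ j → 2 * r ≤ dist (z i) (z j)) → (∀ i ∈ s, f (z i) < r / 2) →
    (s.card : ℝ) * (m / 2) < 1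

lemma segCost_self (x : Euc d) : segCost f β x x = 0 := by simp [segCost]

lemma segCost_nonneg (hf0 : ∀ x, 0 ≤ f x) (x y : Euc d) : 0 ≤ segCost f β x y :=
  mul_nonneg dist_nonneg
    (intervalIntegral.integral_nonneg zero_le_one fun _ _ => Real.rpow_nonneg (hf0 _) _)

lemma continuous_rpow_segment (hf : Continuous f) (hβ : 0 ≤ β) (x y : Euc d) :
    Continuous fun t : ℝ => f (x + t • (y - x)) ^ β :=
  (hf.comp (by fun_prop)).rpow_const fun _ => Or.inr hβ

lemma segCost_le (hf : Continuous f) (hf0 : ∀ x, 0 ≤ f x) (hβ : 0 ≤ β) {x y : Euc d} {M : ℝ}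
    (h : ∀ t ∈ Icc (0 : ℝ) 1, f (x + t • (y - x)) ≤ M) : segCost f β x y ≤ dist x y * M ^ β := by
  refine mul_le_mul_of_nonneg_left ?_ dist_nonneg
  calc _ ≤ ∫ _ in (0 : ℝ)..1, M ^ β := by
        refine intervalIntegral.integral_mono_on zero_le_one
          ((continuous_rpow_segment hf hβ x y).intervalIntegrable _ _) (by simp) fun t ht => ?_
        exact Real.rpow_le_rpow (hf0 _) (h t ht) hβ
    _ = M ^ β := by simp

lemma le_segCost (hf : Continuous f) (hf0 : ∀ x, 0 ≤ f x) (hβ : 0 ≤ β) {x y : Euc d} {A a b : ℝ}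
    (ha : 0 ≤ a) (hab : a ≤ b) (hb : b ≤ 1) (hA : 0 ≤ A)
    (h : ∀ t ∈ Icc a b, A ≤ f (x + t • (y - x))) :
    dist x y * ((b - a) * A ^ β) ≤ segCost f β x y := by
  refine mul_le_mul_of_nonneg_left ?_ dist_nonneg
  have hc := continuous_rpow_segment hf hβ x y
  calc (b - a) * A ^ β = ∫ _ in a..b, A ^ β := by simp
    _ ≤ ∫ t in a..b, f (x + t • (y - x)) ^ β :=
        intervalIntegral.integral_mono_on hab (by simp) (hc.intervalIntegrable _ _)
          fun t ht => Real.rpow_le_rpow hA (h t ht) hβ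
    _ ≤ _ := intervalIntegral.integral_mono_interval ha hab hb
          (Filter.Eventually.of_forall fun t => Real.rpow_nonneg (hf0 _) _)
          (hc.intervalIntegrable _ _)

lemma abs_sub_le_dist (hf : LipschitzWith 1 f) (x y : Euc d) : |f x - f y| ≤ dist x y := by
  simpa [Real.dist_eq] using hf.dist_le_mul x y

lemma dist_segment_points (x y : Euc d) (s t : ℝ) :
    dist (x + s • (y - x)) (x + t • (y - x)) = |s - t| * dist x y := by
  rw [dist_add_left, dist_eq_norm, ← sub_smul, norm_smul, dist_comm x y, dist_eq_norm y x,
    Real.norm_eq_abs]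

/-- A segment cannot consist only of points of low `f`-value. -/
lemma rpow_le_segCost (hf : LipschitzWith 1 f) (hf0 : ∀ x, 0 ≤ f x) (hβ : 0 ≤ β) (hm0 : 0 < m)
    (hm : m < 1) (hpack : PackingBound f m) (x y : Euc d) :
    dist x y * (m / 24 * (m * dist x y / 24) ^ β) ≤ segCost f β x y := by
  set l := dist x y with hl
  rcases (dist_nonneg : 0 ≤ dist x y).eq_or_lt with h0 | hlpos
  · rw [hl, ← h0, zero_mul]; exact segCost_nonneg hf0 x y
  set N := ⌈2 / m⌉₊ with hN
  have hN1 : 2 / m ≤ N := Nat.le_ceil _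
  have hN2 : (N : ℝ) < 2 / m + 1 := Nat.ceil_lt_add_one (by positivity)
  have hNpos : (0 : ℝ) < N := lt_of_lt_of_le (by positivity) hN1
  have h1m : 1 ≤ 1 / m := by rw [le_div_iff₀ hm0]; linarith
  have hN3 : (N : ℝ) ≤ 3 / m := by
    have : 3 / m = 2 / m + 1 / m := by ring
    linarith
  have hNinv : m / 3 ≤ 1 / N := by
    rw [le_div_iff₀ hNpos]
    calc m / 3 * N ≤ m / 3 * (3 / m) := by gcongr
      _ = 1 := by field_simp
  set z : ℕ → Euc d := fun i => x + ((i : ℝ) / N) • (y - x) with hz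
  obtain ⟨i, hi, hfi⟩ : ∃ i ∈ Finset.range (N + 1), l / N / 4 ≤ f (z i) := by
    by_contra! hcon
    have := hpack (Finset.range (N + 1)) z (l / N / 2) (by simp) ?_ ?_
    · rw [Finset.card_range] at this
      have h2 : (2 / m) * (m / 2) = 1 := by field_simp
      push_cast at this
      nlinarith
    · intro i _ j _ hij
      rw [hz]
      simp only [dist_segment_points]
      rw [← hl, ← sub_div, abs_div, abs_of_pos hNpos]
      have : (1 : ℝ) ≤ |(i : ℝ) - j| := by
        have : (1 : ℤ) ≤ |(i : ℤ) - j| := Int.one_le_abs (sub_ne_zero.2 (by exact_mod_cast hij))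
        exact_mod_cast this
      calc 2 * (l / N / 2) = 1 / N * l := by ring
        _ ≤ _ := by gcongr
    · intro i hi
      have := hcon i hi
      linarith
  have hiN : (i : ℝ) ≤ N := by
    have := Finset.mem_range.1 hi
    exact_mod_cast Nat.lt_succ_iff.1 this
  have hN2' : 2 ≤ (N : ℝ) := le_trans (by rw [le_div_iff₀ hm0]; linarith) hN1
  have hNinv2 : 1 / (N : ℝ) ≤ 1 / 2 := one_div_le_one_div_of_le (by norm_num) hN2'
  have hNinv0 : 0 < 1 / (N : ℝ) := by positivity
  have hlow : ∀ t : ℝ, |t - i / N| ≤ 1 / N / 8 → l / N / 8 ≤ f (x + t • (y - x)) := by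
    intro t ht
    have h1 := abs_sub_le_dist hf (x + t • (y - x)) (z i)
    rw [hz, dist_segment_points, ← hl] at h1
    have h2 : |t - i / N| * l ≤ 1 / N / 8 * l := by gcongr
    have h3 : 1 / (N : ℝ) / 8 * l = l / N / 8 := by ring
    have h4 := (abs_le.1 h1).1
    have h5 : l / N / 4 = l / N / 8 + l / N / 8 := by ring
    simp only [hz] at hfi
    linarith
  have hi1 : (i : ℝ) / N ≤ 1 := by rw [div_le_one hNpos]; exact hiN
  have hi0 : 0 ≤ (i : ℝ) / N := by positivity
  have hmain : dist x y * (1 / N / 8 * (l / N / 8) ^ β) ≤ segCost f β x y := by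
    rcases le_total ((i : ℝ) / N) (1 / 2) with hh | hh
    · have := le_segCost hf.continuous hf0 hβ (x := x) (y := y) (A := l / N / 8)
        (a := i / N) (b := i / N + 1 / N / 8) hi0 (by linarith) (by linarith)
        (by positivity) (fun t ht => hlow t (by rw [abs_le]; constructor <;> linarith [ht.1, ht.2]))
      simpa using this
    · have := le_segCost hf.continuous hf0 hβ (x := x) (y := y) (A := l / N / 8)
        (a := i / N - 1 / N / 8) (b := i / N) (by linarith) (by linarith) hi1
        (by positivity) (fun t ht => hlow t (by rw [abs_le]; constructor <;> linarith [ht.1, ht.2]))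
      simpa using this
  refine le_trans ?_ hmain
  have h6 : m * l / 24 ≤ l / N / 8 := by
    calc m * l / 24 = m / 3 * (l / 8) := by ring
      _ ≤ 1 / N * (l / 8) := by gcongr
      _ = l / N / 8 := by ring
  have h7 : m / 24 ≤ 1 / N / 8 := by linarith
  gcongr

lemma max_rpow_le_segCost (hf : LipschitzWith 1 f) (hf0 : ∀ x, 0 ≤ f x) (hβ : 0 ≤ β) (hm0 : 0 < m)
    (hm : m < 1) (hpack : PackingBound f m) (x y : Euc d) :
    dist x y * (m / 24 * (m / 48 * max (dist x y) (f x)) ^ β) ≤ segCost f β x y := by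
  have hl : 0 ≤ dist x y := dist_nonneg
  rcases le_total (f x) (2 * dist x y) with h | h
  · refine le_trans ?_ (rpow_le_segCost hf hf0 hβ hm0 hm hpack x y)
    have h1 : max (dist x y) (f x) ≤ 2 * dist x y := max_le (by linarith) h
    have h2 : m / 48 * max (dist x y) (f x) ≤ m * dist x y / 24 := by nlinarith
    have h3 : 0 ≤ max (dist x y) (f x) := le_max_of_le_left hl
    gcongr
  · have h1 := le_segCost hf.continuous hf0 hβ (x := x) (y := y) (A := f x / 2) le_rfl
      zero_le_one le_rfl (by linarith [hf0 x]) (fun t ht => by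
        have h2 := (abs_le.1 (abs_sub_le_dist hf (x + t • (y - x)) x)).1
        have h3 := dist_segment_points x y t 0
        simp only [zero_smul, add_zero, sub_zero] at h3
        rw [h3, abs_of_nonneg ht.1] at h2
        nlinarith [ht.2])
    refine le_trans ?_ h1
    rw [max_eq_right (by linarith)]
    have h3 : m / 48 * f x ≤ f x / 2 := by nlinarith [hf0 x]
    have h4 : m / 24 ≤ 1 - 0 := by linarith
    have h5 : 0 ≤ f x := hf0 x
    gcongr

lemma exists_separated_subset {r : ℝ} (hr : 0 < r) (z : ℕ → Euc d) (E : Finset ℕ) :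
    ∃ S ⊆ E, (∀ i ∈ S, ∀ j ∈ S, i ≠ j → r ≤ dist (z i) (z j)) ∧
      ∀ k ∈ E, ∃ s ∈ S, dist (z k) (z s) < r := by
  induction E using Finset.induction_on with
  | empty => exact ⟨∅, by simp⟩
  | insert a E _ ih =>
    obtain ⟨S, hSE, hsep, hcov⟩ := ih
    by_cases h : ∃ s ∈ S, dist (z a) (z s) < r
    · refine ⟨S, hSE.trans (Finset.subset_insert _ _), hsep, fun k hk => ?_⟩
      rcases Finset.mem_insert.1 hk with rfl | hk
      · exact h
      · exact hcov k hk
    · push Not at h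
      refine ⟨insert a S, Finset.insert_subset_insert _ hSE, fun i hi j hj hij => ?_,
        fun k hk => ?_⟩
      · rcases Finset.mem_insert.1 hi with hi' | hi' <;> rcases Finset.mem_insert.1 hj with hj' | hj'
        · exact absurd (hi'.trans hj'.symm) hij
        · rw [hi']; exact h j hj'
        · rw [hj', dist_comm]; exact h i hi'
        · exact hsep i hi' j hj' hij
      · rcases Finset.mem_insert.1 hk with rfl | hk
        · exact ⟨k, Finset.mem_insert_self _ _, by simpa using hr⟩
        · obtain ⟨s, hs, hd⟩ := hcov k hk
          exact ⟨s, Finset.mem_insert_of_mem hs, hd⟩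

/-- A chain of points no shortcut of which is cheaper. -/
def IsGeodesicChain (f : Euc d → ℝ) (β : ℝ) (n : ℕ) (z : ℕ → Euc d) : Prop :=
  ∀ i j, i ≤ j → j ≤ n →
    ∑ k ∈ Finset.Ico i j, segCost f β (z k) (z (k + 1)) ≤ segCost f β (z i) (z j)

lemma sum_dist_cluster_le (hf : LipschitzWith 1 f) (hf0 : ∀ x, 0 ≤ f x) (hβ : 0 ≤ β)
    (hm0 : 0 < m) (hm : m < 1) (hpack : PackingBound f m) {n : ℕ} {z : ℕ → Euc d}
    (hgeo : IsGeodesicChain f β n z) {R : ℝ} (hR : 0 < R) (C : Finset ℕ) (hC : ∀ k ∈ C, k < n)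
    (hw : ∀ k ∈ C, R / 2 < max (dist (z k) (z (k + 1))) (f (z k)) ∧
      max (dist (z k) (z (k + 1))) (f (z k)) ≤ R)
    (c : Euc d) (hc : ∀ k ∈ C, dist (z k) c < 6 * R) :
    ∑ k ∈ C, dist (z k) (z (k + 1)) ≤ 289 / m * (1248 / m) ^ β * R := by
  rcases C.eq_empty_or_nonempty with rfl | hne
  · simp only [Finset.sum_empty]; positivity
  set i := C.min' hne with hi
  set j := C.max' hne with hj
  have hiC : i ∈ C := C.min'_mem hne
  have hjC : j ∈ C := C.max'_mem hne
  have hij : i ≤ j := C.min'_le _ hjC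
  have hsub : C.erase j ⊆ Finset.Ico i j := fun k hk => by
    rw [Finset.mem_Ico]
    exact ⟨C.min'_le _ (Finset.mem_of_mem_erase hk),
      lt_of_le_of_ne (C.le_max' _ (Finset.mem_of_mem_erase hk)) (Finset.ne_of_mem_erase hk)⟩
  have hup : segCost f β (z i) (z j) ≤ 12 * R * (13 * R) ^ β := by
    have hd : dist (z i) (z j) ≤ 12 * R := by
      have := dist_triangle_right (z i) (z j) c
      linarith [hc i hiC, hc j hjC]
    refine (segCost_le hf.continuous hf0 hβ (M := 13 * R) fun t ht => ?_).trans (by gcongr)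
    have h2 := (abs_le.1 (abs_sub_le_dist hf (z i + t • (z j - z i)) (z i))).2
    have h3 := dist_segment_points (z i) (z j) t 0
    simp only [zero_smul, add_zero, sub_zero] at h3
    rw [h3, abs_of_nonneg ht.1] at h2
    have h4 := (le_max_right _ _).trans (hw i hiC).2
    nlinarith [ht.2, ht.1, @dist_nonneg _ _ (z i) (z j)]
  have hlow : (∑ k ∈ C.erase j, dist (z k) (z (k + 1))) * (m / 24 * (m / 48 * (R / 2)) ^ β) ≤
      12 * R * (13 * R) ^ β := by
    rw [Finset.sum_mul]
    calc _ ≤ ∑ k ∈ C.erase j, segCost f β (z k) (z (k + 1)) := by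
          refine Finset.sum_le_sum fun k hk => ?_
          refine le_trans ?_ (max_rpow_le_segCost hf hf0 hβ hm0 hm hpack _ _)
          have := (hw k (Finset.mem_of_mem_erase hk)).1.le
          gcongr
      _ ≤ ∑ k ∈ Finset.Ico i j, segCost f β (z k) (z (k + 1)) :=
          Finset.sum_le_sum_of_subset_of_nonneg hsub fun k _ _ => segCost_nonneg hf0 _ _
      _ ≤ _ := (hgeo i j hij (hC j hjC).le).trans hup
  have h13 : (13 * R) ^ β = (1248 / m) ^ β * (m / 48 * (R / 2)) ^ β := by
    rw [← Real.mul_rpow (by positivity) (by positivity)]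
    congr 1
    field_simp
    norm_num
  have hQ : 0 < (m / 48 * (R / 2)) ^ β := by positivity
  have hP : 1 ≤ (1248 / m) ^ β := Real.one_le_rpow (by rw [le_div_iff₀ hm0]; linarith) hβ
  have hmain : ∑ k ∈ C.erase j, dist (z k) (z (k + 1)) ≤ 288 / m * (1248 / m) ^ β * R := by
    rw [h13] at hlow
    refine le_of_mul_le_mul_right (hlow.trans (le_of_eq ?_))
      (show 0 < m / 24 * (m / 48 * (R / 2)) ^ β by positivity)
    field_simp
    norm_num
  have hlast : dist (z j) (z (j + 1)) ≤ 1 / m * (1248 / m) ^ β * R := by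
    have h1 : dist (z j) (z (j + 1)) ≤ R := (le_max_left _ _).trans (hw j hjC).2
    have h2 : 1 ≤ 1 / m := by rw [le_div_iff₀ hm0]; linarith
    have h3 : 1 ≤ 1 / m * (1248 / m) ^ β := one_le_mul_of_one_le_of_one_le h2 hP
    nlinarith
  rw [← Finset.sum_erase_add _ _ hjC]
  calc _ ≤ _ := add_le_add hmain hlast
    _ = _ := by ring

lemma sum_dist_scale_le (hf : LipschitzWith 1 f) (hf0 : ∀ x, 0 ≤ f x) (hβ : 0 ≤ β)
    (hm0 : 0 < m) (hm : m < 1) (hpack : PackingBound f m) {n : ℕ} {z : ℕ → Euc d}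
    (hgeo : IsGeodesicChain f β n z) {R : ℝ} (hR : 0 < R) (E : Finset ℕ) (hE : ∀ k ∈ E, k < n)
    (hw : ∀ k ∈ E, R / 2 < max (dist (z k) (z (k + 1))) (f (z k)) ∧
      max (dist (z k) (z (k + 1))) (f (z k)) ≤ R) :
    ∑ k ∈ E, dist (z k) (z (k + 1)) ≤ 578 / m ^ 2 * (1248 / m) ^ β * R := by
  obtain ⟨S, hSE, hsep, hcov⟩ := exists_separated_subset (r := 6 * R) (by positivity) z E
  choose! σ hσ hσd using hcov
  have hcard : (S.card : ℝ) ≤ 2 / m := by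
    rcases S.eq_empty_or_nonempty with rfl | hne
    · simp only [Finset.card_empty, Nat.cast_zero]; positivity
    · have := hpack S z (3 * R) hne (fun i hi j hj hij => by linarith [hsep i hi j hj hij])
        (fun i hi => by linarith [(le_max_right _ _).trans (hw i (hSE hi)).2])
      rw [le_div_iff₀ hm0]
      linarith
  rw [← Finset.sum_fiberwise_of_maps_to hσ]
  calc _ ≤ ∑ s ∈ S, 289 / m * (1248 / m) ^ β * R := by
        refine Finset.sum_le_sum fun s _ => ?_
        refine sum_dist_cluster_le hf hf0 hβ hm0 hm hpack hgeo hR _ (fun k hk => ?_)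
          (fun k hk => ?_) (z s) (fun k hk => ?_)
        · exact hE k (Finset.mem_filter.1 hk).1
        · exact hw k (Finset.mem_filter.1 hk).1
        · rw [← (Finset.mem_filter.1 hk).2]
          exact hσd k (Finset.mem_filter.1 hk).1
    _ = S.card * (289 / m * (1248 / m) ^ β * R) := by simp
    _ ≤ 2 / m * (289 / m * (1248 / m) ^ β * R) := by gcongr
    _ = _ := by field_simp; norm_num

/-- A geodesic chain has bounded Euclidean length. -/
lemma sum_dist_le_of_isGeodesicChain (hf : LipschitzWith 1 f) (hf0 : ∀ x, 0 ≤ f x) (hβ : 0 ≤ β)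
    (hm0 : 0 < m) (hm : m < 1) (hpack : PackingBound f m) {n : ℕ} {z : ℕ → Euc d}
    (hgeo : IsGeodesicChain f β n z) {D : ℝ} (hD : 0 < D)
    (hw : ∀ k < n, max (dist (z k) (z (k + 1))) (f (z k)) ≤ D) :
    ∑ k ∈ Finset.range n, dist (z k) (z (k + 1)) ≤ 1156 / m ^ 2 * (1248 / m) ^ β * D := by
  set w : ℕ → ℝ := fun k => max (dist (z k) (z (k + 1))) (f (z k)) with hwdef
  set E := (Finset.range n).filter fun k => 0 < w k with hEdef
  have hE : ∑ k ∈ Finset.range n, dist (z k) (z (k + 1)) = ∑ k ∈ E, dist (z k) (z (k + 1)) := by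
    symm
    refine Finset.sum_filter_of_ne fun k _ hk => ?_
    exact lt_max_of_lt_left (lt_of_le_of_ne dist_nonneg (Ne.symm hk))
  have hscale : ∀ k ∈ E, ∃ j : ℕ, D * (1 / 2) ^ j / 2 < w k ∧ w k ≤ D * (1 / 2) ^ j := by
    intro k hk
    rw [hEdef, Finset.mem_filter, Finset.mem_range] at hk
    obtain ⟨j, h1, h2⟩ := exists_nat_pow_near_of_lt_one (x := w k / D) (y := 1 / 2)
      (div_pos hk.2 hD) (by rw [div_le_one hD]; exact hw k hk.1) (by norm_num) (by norm_num)
    refine ⟨j, ?_, ?_⟩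
    · rw [lt_div_iff₀ hD, pow_succ] at h1
      linarith
    · rw [div_le_iff₀ hD] at h2
      linarith
  choose! σ hσ1 hσ2 using hscale
  have hB : 0 ≤ 578 / m ^ 2 * (1248 / m) ^ β := by positivity
  rw [hE, ← Finset.sum_fiberwise_of_maps_to (t := E.image σ)
    (fun k hk => Finset.mem_image_of_mem σ hk)]
  calc _ ≤ ∑ j ∈ E.image σ, 578 / m ^ 2 * (1248 / m) ^ β * (D * (1 / 2) ^ j) := by
        refine Finset.sum_le_sum fun j _ => ?_
        refine sum_dist_scale_le hf hf0 hβ hm0 hm hpack hgeo (by positivity) _ (fun k hk => ?_)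
          (fun k hk => ?_)
        · have := (Finset.mem_filter.1 hk).1
          rw [hEdef, Finset.mem_filter, Finset.mem_range] at this
          exact this.1
        · rw [← (Finset.mem_filter.1 hk).2]
          exact ⟨hσ1 k (Finset.mem_filter.1 hk).1, hσ2 k (Finset.mem_filter.1 hk).1⟩
    _ = 578 / m ^ 2 * (1248 / m) ^ β * D * ∑ j ∈ E.image σ, (1 / 2 : ℝ) ^ j := by
        rw [Finset.mul_sum]
        exact Finset.sum_congr rfl fun j _ => by ring
    _ ≤ 578 / m ^ 2 * (1248 / m) ^ β * D * 2 := by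
        gcongr
        have := summable_geometric_two.sum_le_tsum (E.image σ) fun j _ => by positivity
        rwa [tsum_geometric_two] at this
    _ = _ := by ring

end Chains

section Perturbation

variable {d : ℕ} {f : Euc d → ℝ} {β : ℝ}

lemma rpow_sub_rpow_le (hβ : 1 ≤ β) {a b D : ℝ} (ha : 0 ≤ a) (hab : a ≤ b) (hb : b ≤ D) :
    b ^ β - a ^ β ≤ β * D ^ (β - 1) * (b - a) := by
  have hb0 : 0 ≤ b := ha.trans hab
  refine (convex_Icc a b).image_sub_le_mul_sub_of_deriv_le
    (Real.continuous_rpow_const (by linarith)).continuousOn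
    (Real.differentiable_rpow_const hβ).differentiableOn (fun x hx => ?_) a
    (left_mem_Icc.2 hab) b (right_mem_Icc.2 hab) hab
  have hx' := interior_subset hx
  rw [Real.deriv_rpow_const]
  have : x ^ (β - 1) ≤ D ^ (β - 1) :=
    Real.rpow_le_rpow (ha.trans hx'.1) (hx'.2.trans hb) (by linarith)
  gcongr

lemma segment_mem {K : Set (Euc d)} (hK : Convex ℝ K) {x y : Euc d} (hx : x ∈ K) (hy : y ∈ K)
    {t : ℝ} (ht : t ∈ Icc (0 : ℝ) 1) : x + t • (y - x) ∈ K :=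
  hK.add_smul_sub_mem hx hy ht

lemma segCost_perturb (hf : LipschitzWith 1 f) (hf0 : ∀ x, 0 ≤ f x) (hβ : 1 ≤ β)
    {K : Set (Euc d)} (hK : Convex ℝ K) {D : ℝ} (hD : ∀ x ∈ K, f x ≤ D) {ε : ℝ}
    {x y x' y' : Euc d} (hx : x ∈ K) (hx' : x' ∈ K) (hy' : y' ∈ K)
    (hxx : dist x' x ≤ ε) (hyy : dist y' y ≤ ε) :
    segCost f β x' y' ≤
      segCost f β x y + ε * (β * D ^ (β - 1)) * dist x y + 2 * ε * D ^ β := by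
  have hβ0 : 0 ≤ β := by linarith
  have hε : 0 ≤ ε := dist_nonneg.trans hxx
  have hD0 : 0 ≤ D := (hf0 x).trans (hD x hx)
  have hd : dist x' y' ≤ dist x y + 2 * ε := by
    have h1 := dist_triangle4 x' x y y'
    rw [dist_comm y y'] at h1
    linarith
  have hc := continuous_rpow_segment hf.continuous hβ0 x y
  have hc' := continuous_rpow_segment hf.continuous hβ0 x' y'
  have hτ : 0 ≤ β * D ^ (β - 1) := mul_nonneg hβ0 (Real.rpow_nonneg hD0 _)
  set I := ∫ t in (0 : ℝ)..1, f (x + t • (y - x)) ^ β with hI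
  set I' := ∫ t in (0 : ℝ)..1, f (x' + t • (y' - x')) ^ β with hI'
  have hI'0 : 0 ≤ I' :=
    intervalIntegral.integral_nonneg zero_le_one fun _ _ => Real.rpow_nonneg (hf0 _) _
  have hI_le : I' ≤ D ^ β := by
    calc I' ≤ ∫ _ in (0 : ℝ)..1, D ^ β :=
          intervalIntegral.integral_mono_on zero_le_one (hc'.intervalIntegrable _ _) (by simp)
            fun t ht => Real.rpow_le_rpow (hf0 _) (hD _ (segment_mem hK hx' hy' ht)) hβ0
      _ = D ^ β := by simp
  have hII : I' ≤ I + ε * (β * D ^ (β - 1)) := by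
    calc I' ≤ ∫ t in (0 : ℝ)..1, (f (x + t • (y - x)) ^ β + ε * (β * D ^ (β - 1))) := by
          refine intervalIntegral.integral_mono_on zero_le_one (hc'.intervalIntegrable _ _)
            ((hc.add continuous_const).intervalIntegrable _ _) fun t ht => ?_
          set a := f (x + t • (y - x)) with ha
          set b := f (x' + t • (y' - x')) with hb
          have hab : b ≤ a + ε := by
            have h1 := (abs_le.1 (abs_sub_le_dist hf (x' + t • (y' - x')) (x + t • (y - x)))).2
            have h2 : dist (x' + t • (y' - x')) (x + t • (y - x)) ≤ ε := by
              rw [dist_eq_norm] at hxx hyy ⊢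
              have : x' + t • (y' - x') - (x + t • (y - x)) =
                  (1 - t) • (x' - x) + t • (y' - y) := by module
              rw [this]
              refine (norm_add_le _ _).trans ?_
              rw [norm_smul, norm_smul, Real.norm_of_nonneg ht.1,
                Real.norm_of_nonneg (by linarith [ht.2])]
              nlinarith [ht.1, ht.2]
            linarith
          rcases le_total b a with hba | hba
          · have := Real.rpow_le_rpow (hf0 _) hba hβ0
            have : 0 ≤ ε * (β * D ^ (β - 1)) := by positivity
            linarith
          · have := rpow_sub_rpow_le hβ (hf0 _) hba (hD _ (segment_mem hK hx' hy' ht))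
            nlinarith
      _ = I + ε * (β * D ^ (β - 1)) := by
          rw [intervalIntegral.integral_add (hc.intervalIntegrable _ _) (by simp)]
          simp [hI]
  have hxy : 0 ≤ dist x y := dist_nonneg
  calc segCost f β x' y' = dist x' y' * I' := rfl
    _ ≤ (dist x y + 2 * ε) * I' := by gcongr
    _ = dist x y * I' + 2 * ε * I' := by ring
    _ ≤ dist x y * (I + ε * (β * D ^ (β - 1))) + 2 * ε * D ^ β := by gcongr
    _ = _ := by rw [segCost]; ring

lemma segCost_merge (hf : LipschitzWith 1 f) (hf0 : ∀ x, 0 ≤ f x) (hβ : 1 ≤ β)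
    {K : Set (Euc d)} (hK : Convex ℝ K) {D : ℝ} (hD : ∀ x ∈ K, f x ≤ D) {z : ℕ → Euc d}
    {n i j : ℕ} (hz : ∀ k ≤ n, z k ∈ K) (hij : i ≤ j) (hj : j ≤ n) {L : ℝ}
    (hL : ∑ k ∈ Finset.Ico i j, dist (z k) (z (k + 1)) ≤ L) :
    segCost f β (z i) (z j) ≤ ∑ k ∈ Finset.Ico i j, segCost f β (z k) (z (k + 1)) +
      2 * L * (β * D ^ (β - 1)) * ∑ k ∈ Finset.Ico i j, dist (z k) (z (k + 1)) := by
  have hβ0 : 0 ≤ β := by linarith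
  set S := ∑ k ∈ Finset.Ico i j, dist (z k) (z (k + 1)) with hS
  have hS0 : 0 ≤ S := Finset.sum_nonneg fun _ _ => dist_nonneg
  have hi : z i ∈ K := hz i (hij.trans hj)
  have hD0 : 0 ≤ D := (hf0 _).trans (hD _ hi)
  have hdS : dist (z i) (z j) ≤ S := dist_le_Ico_sum_dist z hij
  set M := f (z i) with hM
  have hM0 : 0 ≤ M := hf0 _
  have hMD : M ≤ D := hD _ hi
  set A := max (M - L) 0 with hA
  set B := min (M + L) D with hB
  have hA0 : 0 ≤ A := le_max_right _ _
  have hAB : A ≤ B := by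
    refine max_le (le_min ?_ ?_) (le_min ?_ hD0) <;> linarith
  have hBA : B - A ≤ 2 * L := by
    have h1 : B ≤ M + L := min_le_left _ _
    have h2 : M - L ≤ A := le_max_left _ _
    linarith
  have hup : segCost f β (z i) (z j) ≤ S * B ^ β := by
    refine (segCost_le hf.continuous hf0 hβ0 (M := B) fun t ht => ?_).trans
      (mul_le_mul_of_nonneg_right hdS (Real.rpow_nonneg (hA0.trans hAB) _))
    refine le_min ?_ (hD _ (segment_mem hK hi (hz j hj) ht))
    have h2 := (abs_le.1 (abs_sub_le_dist hf (z i + t • (z j - z i)) (z i))).2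
    have h3 := dist_segment_points (z i) (z j) t 0
    simp only [zero_smul, add_zero, sub_zero] at h3
    rw [h3, abs_of_nonneg ht.1] at h2
    nlinarith [ht.2, ht.1, @dist_nonneg _ _ (z i) (z j)]
  have hlow : S * A ^ β ≤ ∑ k ∈ Finset.Ico i j, segCost f β (z k) (z (k + 1)) := by
    rw [hS, Finset.sum_mul]
    refine Finset.sum_le_sum fun k hk => ?_
    have hk' := Finset.mem_Ico.1 hk
    have := le_segCost hf.continuous hf0 hβ0 (x := z k) (y := z (k + 1)) le_rfl zero_le_one le_rfl
      hA0 (fun t ht => ?_)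
    · simpa using this
    refine max_le ?_ (hf0 _)
    have h2 := (abs_le.1 (abs_sub_le_dist hf (z k + t • (z (k + 1) - z k)) (z i))).1
    have h3 := dist_segment_points (z k) (z (k + 1)) t 0
    simp only [zero_smul, add_zero, sub_zero] at h3
    rw [abs_of_nonneg ht.1] at h3
    have h4 := dist_triangle (z k + t • (z (k + 1) - z k)) (z k) (z i)
    have h5 : dist (z i) (z k) ≤ ∑ l ∈ Finset.Ico i k, dist (z l) (z (l + 1)) :=
      dist_le_Ico_sum_dist z hk'.1
    have h6 : ∑ l ∈ Finset.Ico i (k + 1), dist (z l) (z (l + 1)) ≤ S :=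
      Finset.sum_le_sum_of_subset_of_nonneg (Finset.Ico_subset_Ico_right hk'.2)
        fun _ _ _ => dist_nonneg
    rw [Finset.sum_Ico_succ_top hk'.1] at h6
    rw [dist_comm (z k) (z i)] at h4
    nlinarith [ht.2, ht.1, @dist_nonneg _ _ (z k) (z (k + 1))]
  have hpow := rpow_sub_rpow_le hβ hA0 hAB (min_le_right _ _)
  have hτ : 0 ≤ β * D ^ (β - 1) := mul_nonneg hβ0 (Real.rpow_nonneg hD0 _)
  have h7 : B ^ β - A ^ β ≤ 2 * L * (β * D ^ (β - 1)) := by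
    calc _ ≤ _ := hpow
      _ ≤ β * D ^ (β - 1) * (2 * L) := by gcongr
      _ = _ := by ring
  nlinarith

/-- Comparison of a chain with a nearby coarser one: `C` is any cost function that is at most the
cost of a segment and satisfies the triangle inequality at points of `G`. -/
lemma cost_le_of_nearby_chain (hf : LipschitzWith 1 f) (hf0 : ∀ x, 0 ≤ f x) (hβ : 1 ≤ β)
    {K : Set (Euc d)} (hK : Convex ℝ K) {D : ℝ} (hD : ∀ x ∈ K, f x ≤ D) {G : Set (Euc d)}
    {C : Euc d → Euc d → ℝ} (hC1 : ∀ x y, C x y ≤ segCost f β x y)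
    (hC2 : ∀ x y, ∀ z ∈ G, C x y ≤ C x z + C z y) {n : ℕ} {z q : ℕ → Euc d} {ε L : ℝ}
    (hz : ∀ k ≤ n, z k ∈ K) (hq : ∀ k ≤ n, q k ∈ K) (hqG : ∀ k, 0 < k → k < n → q k ∈ G)
    (hqz : ∀ k ≤ n, dist (q k) (z k) ≤ ε) (hL : 0 < L) :
    C (q 0) (q n) ≤ ∑ k ∈ Finset.range n, segCost f β (z k) (z (k + 1)) +
      (2 * L + ε) * (β * D ^ (β - 1)) * ∑ k ∈ Finset.range n, dist (z k) (z (k + 1)) +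
      2 * ε * D ^ β * (2 * (∑ k ∈ Finset.range n, dist (z k) (z (k + 1))) / L + 2) := by
  have hε : 0 ≤ ε := dist_nonneg.trans (hqz 0 (Nat.zero_le _))
  have hD0 : 0 ≤ D := (hf0 _).trans (hD _ (hz 0 (Nat.zero_le _)))
  set τ := β * D ^ (β - 1) with hτdef
  have hτ : 0 ≤ τ := mul_nonneg (by linarith) (Real.rpow_nonneg hD0 _)
  set κ := 2 * ε * D ^ β with hκdef
  have hκ : 0 ≤ κ := by positivity
  set s : ℕ → ℕ → ℝ := fun i j => ∑ k ∈ Finset.Ico i j, segCost f β (z k) (z (k + 1)) with hs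
  set l : ℕ → ℕ → ℝ := fun i j => ∑ k ∈ Finset.Ico i j, dist (z k) (z (k + 1)) with hl
  have hs0 : ∀ i j, 0 ≤ s i j := fun i j => Finset.sum_nonneg fun _ _ => segCost_nonneg hf0 _ _
  have hl0 : ∀ i j, 0 ≤ l i j := fun i j => Finset.sum_nonneg fun _ _ => dist_nonneg
  have hgroup : ∀ i j, i ≤ j → j ≤ n → l i j ≤ L →
      C (q i) (q j) ≤ s i j + (2 * L + ε) * τ * l i j + κ := by
    intro i j hij hj hlL
    have h1 := segCost_perturb hf hf0 hβ hK hD (hz i (hij.trans hj))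
      (hq i (hij.trans hj)) (hq j hj) (hqz i (hij.trans hj)) (hqz j hj)
    have h2 := segCost_merge hf hf0 hβ hK hD hz hij hj hlL
    have h3 : dist (z i) (z j) ≤ l i j := dist_le_Ico_sum_dist z hij
    have h4 : ε * τ * dist (z i) (z j) ≤ ε * τ * l i j := by gcongr
    have h5 := hC1 (q i) (q j)
    simp only [hs, hl] at *
    linarith
  have hedge : ∀ i, i < n → C (q i) (q (i + 1)) ≤
      s i (i + 1) + (2 * L + ε) * τ * l i (i + 1) + κ := by
    intro i hi
    have h1 := segCost_perturb hf hf0 hβ hK hD (hz i hi.le)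
      (hq i hi.le) (hq (i + 1) hi) (hqz i hi.le) (hqz (i + 1) hi)
    have h5 := hC1 (q i) (q (i + 1))
    have h6 : 0 ≤ 2 * L * τ * dist (z i) (z (i + 1)) := by positivity
    simp only [hs, hl, Nat.Ico_succ_singleton, Finset.sum_singleton] at *
    linarith
  have hmain : ∀ N i, i ≤ n → n - i ≤ N →
      C (q i) (q n) ≤ s i n + (2 * L + ε) * τ * l i n + κ * (2 * l i n / L + 2) := by
    intro N
    induction N with
    | zero =>
      intro i hi hN
      have := hgroup i n hi le_rfl (by
        have : i = n := by omega
        subst this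
        simp [hl, hL.le])
      have h2 : 0 ≤ κ * (2 * l i n / L) := by have := hl0 i n; positivity
      linarith
    | succ N ih =>
      intro i hi hN
      by_cases hLn : l i n ≤ L
      · have := hgroup i n hi le_rfl hLn
        have h2 : 0 ≤ κ * (2 * l i n / L) := by have := hl0 i n; positivity
        linarith
      obtain ⟨j, hij, hjn, hjL, hjL'⟩ : ∃ j, i ≤ j ∧ j < n ∧ l i j ≤ L ∧ L < l i (j + 1) := by
        by_contra! hcon
        have : ∀ j, i ≤ j → j ≤ n → l i j ≤ L := by
          intro j hij
          induction j, hij using Nat.le_induction with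
          | base => intro _; simp [hl, hL.le]
          | succ j hij ihj => intro hj; exact hcon j hij (by omega) (ihj (by omega))
        exact hLn (this n hi le_rfl)
      have h1 := hgroup i j hij hjn.le hjL
      have h2 := hedge j hjn
      have hs3 : s i (j + 1) = s i j + s j (j + 1) :=
        (Finset.sum_Ico_consecutive _ hij (Nat.le_succ j)).symm
      have hl3 : l i (j + 1) = l i j + l j (j + 1) :=
        (Finset.sum_Ico_consecutive _ hij (Nat.le_succ j)).symm
      have h3 : C (q i) (q (j + 1)) ≤
          s i (j + 1) + (2 * L + ε) * τ * l i (j + 1) + 2 * κ := by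
        rw [hs3, hl3]
        rcases hij.eq_or_lt with h | h
        · subst h
          have h4 := hs0 i i
          have h5 : 0 ≤ (2 * L + ε) * τ * l i i := by have := hl0 i i; positivity
          linarith
        · have := hC2 (q i) (q (j + 1)) (q j) (hqG j (by omega) hjn)
          linarith
      have hone : 2 * κ ≤ κ * (2 * l i (j + 1) / L) := by
        rw [mul_comm 2 κ]
        refine mul_le_mul_of_nonneg_left ?_ hκ
        rw [le_div_iff₀ hL]
        linarith
      have hs4 : s i n = s i (j + 1) + s (j + 1) n :=
        (Finset.sum_Ico_consecutive _ (by omega) hjn).symm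
      have hl4 : l i n = l i (j + 1) + l (j + 1) n :=
        (Finset.sum_Ico_consecutive _ (by omega) hjn).symm
      rcases (show j + 1 ≤ n from hjn).eq_or_lt with h | h
      · rw [← h]
        linarith
      · have h5 := hC2 (q i) (q n) (q (j + 1)) (hqG _ (by omega) h)
        have h6 := ih (j + 1) h.le (by omega)
        rw [hs4, hl4]
        have h7 : κ * (2 * (l i (j + 1) + l (j + 1) n) / L + 2) =
            κ * (2 * l i (j + 1) / L) + κ * (2 * l (j + 1) n / L + 2) := by ring
        rw [h7]
        linarith
  have := hmain n 0 (Nat.zero_le _) (by omega)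
  simpa only [hs, hl, Finset.range_eq_Ico] using this

end Perturbation

section ChainConstruction

variable {d : ℕ} {f : Euc d → ℝ} {β : ℝ} {F : Set (Euc d)} {x y : Euc d}

/-- The points `z 0, …, z n` form a chain from `x` to `y` with interior points in `F`. -/
def IsChainIn (F : Set (Euc d)) (x y : Euc d) (n : ℕ) (z : ℕ → Euc d) : Prop :=
  z 0 = x ∧ z n = y ∧ ∀ k, 0 < k → k < n → z k ∈ F

/-- The cost of a chain. -/
def chainCost (f : Euc d → ℝ) (β : ℝ) (n : ℕ) (z : ℕ → Euc d) : ℝ :=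
  ∑ k ∈ Finset.range n, segCost f β (z k) (z (k + 1))

lemma IsChainIn.shortcut {n : ℕ} {z : ℕ → Euc d} (hz : IsChainIn F x y n z) {i j : ℕ}
    (hij : i + 1 < j) (hj : j ≤ n)
    (hcost : segCost f β (z i) (z j) ≤
      ∑ k ∈ Finset.Ico i j, segCost f β (z k) (z (k + 1))) :
    ∃ n' < n, ∃ z', IsChainIn F x y n' z' ∧ chainCost f β n' z' ≤ chainCost f β n z := by
  obtain ⟨e, rfl⟩ : ∃ e, j = i + 1 + (e + 1) := ⟨j - i - 2, by omega⟩
  obtain ⟨r, rfl⟩ : ∃ r, n = i + 1 + (e + 1) + r := ⟨n - (i + 1 + (e + 1)), by omega⟩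
  refine ⟨i + 1 + r, by omega, fun k => if k ≤ i then z k else z (k + (e + 1)),
    ⟨by simpa using hz.1, ?_, fun k hk0 hk => ?_⟩, ?_⟩
  · have : ¬ i + 1 + r ≤ i := by omega
    simp only [this, if_false]
    rw [← hz.2.1]
    congr 1
    omega
  · dsimp only
    split_ifs with h
    · exact hz.2.2 k hk0 (by omega)
    · exact hz.2.2 _ (by omega) (by omega)
  · rw [chainCost, chainCost, Finset.range_eq_Ico, Finset.range_eq_Ico,
      ← Finset.sum_Ico_consecutive _ (Nat.zero_le i) (show i ≤ i + 1 + r by omega),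
      ← Finset.sum_Ico_consecutive _ (Nat.zero_le i) (show i ≤ i + 1 + (e + 1) + r by omega),
      ← Finset.sum_Ico_consecutive _ (Nat.le_succ i) (show i + 1 ≤ i + 1 + r by omega),
      ← Finset.sum_Ico_consecutive _ (show i ≤ i + 1 + (e + 1) by omega)
        (show i + 1 + (e + 1) ≤ i + 1 + (e + 1) + r by omega)]
    refine add_le_add (le_of_eq ?_) (add_le_add ?_ (le_of_eq ?_))
    · refine Finset.sum_congr rfl fun k hk => ?_
      have := (Finset.mem_Ico.1 hk).2
      rw [if_pos (by omega), if_pos (by omega)]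
    · rw [Nat.Ico_succ_singleton, Finset.sum_singleton, if_pos le_rfl, if_neg (by omega)]
      exact hcost
    · rw [Finset.sum_Ico_eq_sum_range, Finset.sum_Ico_eq_sum_range]
      refine Finset.sum_congr (by congr 1; omega) fun k _ => ?_
      rw [if_neg (by omega), if_neg (by omega)]
      congr 2 <;> omega

/-- Discarding useless points turns a chain into a geodesic chain. -/
lemma IsChainIn.exists_isGeodesicChain {n : ℕ} {z : ℕ → Euc d} (hz : IsChainIn F x y n z) :
    ∃ n' z', IsChainIn F x y n' z' ∧ chainCost f β n' z' ≤ chainCost f β n z ∧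
      IsGeodesicChain f β n' z' := by
  classical
  have hex : ∃ n', ∃ z', IsChainIn F x y n' z' ∧ chainCost f β n' z' ≤ chainCost f β n z :=
    ⟨n, z, hz, le_rfl⟩
  obtain ⟨z', hz', hc⟩ := Nat.find_spec hex
  refine ⟨_, z', hz', hc, fun i j hij hj => ?_⟩
  rcases (show j = i ∨ j = i + 1 ∨ i + 1 < j by omega) with h | h | h
  · simp [h, segCost_self]
  · simp [h]
  · by_contra! hcon
    obtain ⟨n'', hn'', z'', hz'', hc''⟩ := hz'.shortcut h hj hcon.le
    exact Nat.find_min hex hn'' ⟨z'', hz'', hc''.trans hc⟩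

lemma IsChainIn.cons {n : ℕ} {z : ℕ → Euc d} (hz : IsChainIn F x y n z) (hx : x ∈ F) (v : Euc d) :
    ∃ z', IsChainIn F v y (n + 1) z' ∧
      chainCost f β (n + 1) z' = segCost f β v x + chainCost f β n z := by
  refine ⟨fun k => Nat.casesOn k v z, ⟨rfl, hz.2.1, fun k hk0 hk => ?_⟩, ?_⟩
  · obtain ⟨k, rfl⟩ := Nat.exists_eq_succ_of_ne_zero hk0.ne'
    rcases Nat.eq_zero_or_pos k with rfl | hk'
    · simpa [hz.1] using hx
    · exact hz.2.2 k hk' (by omega)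
  · rw [chainCost, Finset.sum_range_succ', add_comm, chainCost]
    simp [hz.1]

/-- Discretization of a continuous path into a chain. -/
lemma exists_isChainIn_of_path {γ : ℝ → Euc d} (hγ : Continuous γ) (hF : IsClosed F) {W : ℝ → ℝ}
    {h : ℝ} (hh : 0 < h)
    (hclose : ∀ s t, 0 ≤ s → s ≤ t → t ≤ 1 → t - s ≤ h → segCost f β (γ s) (γ t) ≤ W t - W s)
    (hstraight : ∀ s t, 0 ≤ s → s ≤ t → t ≤ 1 → (∀ r ∈ Ioo s t, γ r ∉ F) →
      segCost f β (γ s) (γ t) ≤ W t - W s) :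
    ∃ n z, IsChainIn F (γ 0) (γ 1) n z ∧ chainCost f β n z ≤ W 1 - W 0 := by
  set P : ℝ → Prop := fun s =>
    ∃ n z, IsChainIn F (γ s) (γ 1) n z ∧ chainCost f β n z ≤ W 1 - W s with hP
  have hend : ∀ s, segCost f β (γ s) (γ 1) ≤ W 1 - W s → P s := fun s hs =>
    ⟨1, fun k => if k = 0 then γ s else γ 1, ⟨by simp, by simp, fun k _ _ => by omega⟩,
      by simpa [chainCost] using hs⟩
  have hstep : ∀ s t, segCost f β (γ s) (γ t) ≤ W t - W s → γ t ∈ F → P t → P s := by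
    rintro s t hst htF ⟨n, z, hz, hc⟩
    obtain ⟨z', hz', hc'⟩ := hz.cons (f := f) (β := β) htF (γ s)
    exact ⟨n + 1, z', hz', by linarith⟩
  have hcl : IsClosed (γ ⁻¹' F) := hF.preimage hγ
  have key : ∀ N : ℕ, ∀ s, 0 ≤ s → s ≤ 1 → 1 - s ≤ (N + 1) * h → P s := by
    intro N
    induction N with
    | zero =>
      intro s hs0 hs1 hN
      exact hend s (hclose s 1 hs0 hs1 le_rfl (by simpa using hN))
    | succ N ih =>
      intro s hs0 hs1 hN
      push_cast at hN
      by_cases hsh : 1 - s ≤ h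
      · exact hend s (hclose s 1 hs0 hs1 le_rfl hsh)
      push Not at hsh
      have hfar : ∀ t, s ≤ t → t < s + h → (∀ r ∈ Ioo t (s + h), γ r ∉ F) → P t := by
        intro t hst hts hno
        have hcomp : IsCompact ((γ ⁻¹' F ∪ {1}) ∩ Icc (s + h) 1) :=
          isCompact_Icc.inter_left (hcl.union isClosed_singleton)
        obtain ⟨t', ⟨htF, ht'⟩, hmin⟩ := hcomp.exists_isLeast
          ⟨1, Or.inr rfl, by linarith, le_rfl⟩
        by_cases hsF : γ (s + h) ∈ F
        · exact hstep t (s + h) (hstraight t (s + h) (by linarith) hts.le (by linarith) hno) hsF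
            (ih _ (by linarith) (by linarith) (by linarith))
        have hno' : ∀ r ∈ Ioo t t', γ r ∉ F := by
          intro r hr hrF
          rcases lt_trichotomy r (s + h) with hr' | hr' | hr'
          · exact hno r ⟨hr.1, hr'⟩ hrF
          · exact hsF (hr' ▸ hrF)
          · exact absurd (hmin ⟨Or.inl hrF, hr'.le, hr.2.le.trans ht'.2⟩) (not_le.2 hr.2)
        have hc := hstraight t t' (by linarith) (by linarith [ht'.1]) ht'.2 hno'
        rcases htF with h1 | h1
        · exact hstep t t' hc h1 (ih _ (by linarith [ht'.1]) ht'.2 (by linarith [ht'.1]))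
        · rw [mem_singleton_iff] at h1
          rw [h1] at hc
          exact hend t hc
      have hcomp : IsCompact ((γ ⁻¹' F ∪ {s}) ∩ Icc s (s + h)) :=
        isCompact_Icc.inter_left (hcl.union isClosed_singleton)
      obtain ⟨t, ⟨htF, ht⟩, hmax⟩ := hcomp.exists_isGreatest
        ⟨s, Or.inr rfl, le_rfl, by linarith⟩
      have hno : ∀ r ∈ Ioo t (s + h), γ r ∉ F := fun r hr hrF =>
        absurd (hmax ⟨Or.inl hrF, ht.1.trans hr.1.le, hr.2.le⟩) (not_le.2 hr.1)
      have hPt : P t := by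
        rcases ht.2.eq_or_lt with h1 | h1
        · exact ih t (by linarith) (by linarith) (by linarith)
        · exact hfar t ht.1 h1 hno
      rcases htF with h1 | h1
      · exact hstep s t (hclose s t hs0 ht.1 (by linarith [ht.2]) (by linarith [ht.2])) h1 hPt
      · rw [mem_singleton_iff] at h1
        rwa [h1] at hPt
  obtain ⟨N, hN⟩ := exists_nat_gt (1 / h)
  refine key N 0 le_rfl zero_le_one ?_
  rw [div_lt_iff₀ hh] at hN
  linarith

end ChainConstruction

section PathCost

variable {d : ℕ} {f : Euc d → ℝ} {β : ℝ} {γ : ℝ → Euc d} {C : ℝ≥0}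

open intervalIntegral

/-- The cost of the part of the path `γ` with parameter between `s` and `t`. -/
def pathCost (f : Euc d → ℝ) (β : ℝ) (γ : ℝ → Euc d) (s t : ℝ) : ℝ :=
  ∫ τ in s..t, f (γ τ) ^ β * ‖deriv γ τ‖

lemma intervalIntegrable_deriv (hγ : LipschitzWith C γ) (s t : ℝ) :
    IntervalIntegrable (deriv γ) volume s t := by
  refine (_root_.intervalIntegrable_const (c := (C : ℝ))).mono_fun
    (measurable_deriv γ).aestronglyMeasurable ?_
  refine Filter.Eventually.of_forall fun τ => ?_
  simpa using norm_deriv_le_of_lipschitz hγ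

lemma intervalIntegrable_rpow_mul_norm_deriv (hf : Continuous f) (hβ : 0 ≤ β)
    (hγ : LipschitzWith C γ) (s t : ℝ) :
    IntervalIntegrable (fun τ => f (γ τ) ^ β * ‖deriv γ τ‖) volume s t :=
  (intervalIntegrable_deriv hγ s t).norm.continuousOn_mul
    ((hf.comp hγ.continuous).rpow_const fun _ => Or.inr hβ).continuousOn

lemma integral_deriv_eq_sub_of_lipschitz (hγ : LipschitzWith C γ) (s t : ℝ) :
    ∫ τ in s..t, deriv γ τ = γ t - γ s := by
  refine ext_inner_left ℝ fun v => ?_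
  have hv : LipschitzWith (‖innerSL ℝ v‖₊ * C) fun τ => innerSL ℝ v (γ τ) :=
    (innerSL ℝ v).lipschitz.comp hγ
  have h1 := (hv.lipschitzOnWith (s := uIcc s t)).absolutelyContinuousOnInterval.integral_deriv_eq_sub
  have h2 := (innerSL ℝ v).intervalIntegral_comp_comm (intervalIntegrable_deriv hγ s t)
  simp only [innerSL_apply_apply] at h1 h2
  rw [← h2, inner_sub_right, ← h1]
  refine integral_congr_ae ?_
  filter_upwards [hγ.ae_differentiableAt_real] with τ hτ _
  exact ((innerSL ℝ v).hasFDerivAt.comp_hasDerivAt τ hτ.hasDerivAt).deriv.symm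

lemma dist_le_integral_norm_deriv (hγ : LipschitzWith C γ) {s t : ℝ} (hst : s ≤ t) :
    dist (γ s) (γ t) ≤ ∫ τ in s..t, ‖deriv γ τ‖ := by
  rw [dist_comm, dist_eq_norm, ← integral_deriv_eq_sub_of_lipschitz hγ]
  exact norm_integral_le_integral_norm hst

lemma segCost_le_pathCost_of_straight (hf : Continuous f) (hβ : 0 ≤ β) (hγ : LipschitzWith C γ)
    {s t : ℝ} (hst : s ≤ t) {u : Euc d} (hu : ‖u‖ = 1)
    (hstr : ∀ᵐ τ ∂(volume.restrict (Ioo s t)), deriv γ τ = ‖deriv γ τ‖ • u) :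
    segCost f β (γ s) (γ t) ≤ pathCost f β γ s t := by
  set h : ℝ → ℝ := fun τ => innerSL ℝ u (γ τ - γ s) with hdef
  set φ : ℝ → ℝ := fun σ => f (γ s + σ • u) ^ β with hφ
  set Φ : ℝ → ℝ := fun ρ => ∫ σ in (0 : ℝ)..ρ, φ σ with hΦ
  have hφc : Continuous φ := (hf.comp (by fun_prop)).rpow_const fun _ => Or.inr hβ
  have hΦd : ∀ ρ, HasDerivAt Φ (φ ρ) ρ := fun ρ => hφc.integral_hasStrictDerivAt 0 ρ |>.hasDerivAt
  have hΦ1 : ContDiff ℝ 1 Φ := by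
    rw [contDiff_one_iff_deriv]
    refine ⟨fun ρ => (hΦd ρ).differentiableAt, ?_⟩
    rwa [show deriv Φ = φ from funext fun ρ => (hΦd ρ).deriv]
  have hstr' : ∀ᵐ τ ∂volume, τ ∈ Ioo s t → deriv γ τ = ‖deriv γ τ‖ • u :=
    (ae_restrict_iff' measurableSet_Ioo).1 hstr
  have hpt : ∀ τ ∈ Icc s t, γ τ - γ s = (∫ r in s..τ, ‖deriv γ r‖) • u := by
    intro τ hτ
    rw [← integral_deriv_eq_sub_of_lipschitz hγ, ← intervalIntegral.integral_smul_const]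
    refine integral_congr_ae ?_
    filter_upwards [hstr', (volume : Measure ℝ).ae_ne t] with r hr hrt hr'
    rw [uIoc_of_le hτ.1] at hr'
    exact hr ⟨hr'.1, lt_of_le_of_ne (hr'.2.trans hτ.2) hrt⟩
  have hh : ∀ τ ∈ Icc s t, h τ = ∫ r in s..τ, ‖deriv γ r‖ := by
    intro τ hτ
    simp only [hdef, hpt τ hτ, innerSL_apply_apply, inner_smul_right, real_inner_self_eq_norm_sq,
      hu, one_pow, mul_one]
  have hpt' : ∀ τ ∈ Icc s t, γ τ = γ s + h τ • u := by
    intro τ hτ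
    rw [hh τ hτ, ← hpt τ hτ, add_sub_cancel]
  have hhL : LipschitzWith (‖innerSL ℝ u‖₊ * C) h :=
    (innerSL ℝ u).lipschitz.comp (g := fun τ => γ τ - γ s)
      (LipschitzWith.of_dist_le_mul fun a b => by simpa using hγ.dist_le_mul a b)
  obtain ⟨C', hC'⟩ := LocallyLipschitzOn.exists_lipschitzOnWith_of_compact
    (isCompact_Icc.image hhL.continuous : IsCompact (h '' Icc s t))
    (hΦ1.locallyLipschitz.locallyLipschitzOn)
  have hgL : LipschitzOnWith (C' * (‖innerSL ℝ u‖₊ * C)) (Φ ∘ h) (uIcc s t) := by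
    rw [uIcc_of_le hst]
    exact hC'.comp hhL.lipschitzOnWith (mapsTo_image h _)
  have hmain := hgL.absolutelyContinuousOnInterval.integral_deriv_eq_sub
  have hs0 : h s = 0 := by simp [hdef]
  have hcost : pathCost f β γ s t = Φ (h t) := by
    have : Φ (h s) = 0 := by simp [hs0, hΦ]
    rw [← sub_zero (Φ (h t)), ← this]
    refine Eq.trans ?_ hmain
    refine integral_congr_ae ?_
    filter_upwards [hstr', (volume : Measure ℝ).ae_ne t, hγ.ae_differentiableAt_real] with τ hτ hτt
      hd hτ'
    rw [uIoc_of_le hst] at hτ'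
    have hh' : HasDerivAt h ‖deriv γ τ‖ τ := by
      have h1 := (innerSL ℝ u).hasFDerivAt.comp_hasDerivAt τ (hd.hasDerivAt.sub_const (γ s))
      rw [hτ ⟨hτ'.1, lt_of_le_of_ne hτ'.2 hτt⟩] at h1
      have h2 : innerSL ℝ u (‖deriv γ τ‖ • u) = ‖deriv γ τ‖ := by
        simp [hu]
      rwa [h2] at h1
    have h2 := (hΦd (h τ)).comp τ hh'
    rw [h2.deriv, hφ]
    simp only
    rw [← hpt' τ (Ioc_subset_Icc_self hτ')]
  have hht : 0 ≤ h t := by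
    rw [hh t (right_mem_Icc.2 hst)]
    exact integral_nonneg hst fun _ _ => norm_nonneg _
  rw [hcost, segCost]
  have e1 : dist (γ s) (γ t) = h t := by
    rw [dist_comm, dist_eq_norm, hpt' t (right_mem_Icc.2 hst), add_sub_cancel_left, norm_smul, hu,
      mul_one, Real.norm_of_nonneg hht]
  have e2 : ∀ r : ℝ, f (γ s + r • (γ t - γ s)) ^ β = φ (r * h t) := by
    intro r
    rw [hφ]
    simp only
    rw [mul_smul, hpt' t (right_mem_Icc.2 hst), add_sub_cancel_left]
  simp_rw [e1, e2, intervalIntegral.mul_integral_comp_mul_right]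
  simp [hΦ]

lemma exists_segCost_le_pathCost_add (hf : LipschitzWith 1 f) (hf0 : ∀ x, 0 ≤ f x) (hβ : 1 ≤ β)
    (hγ : LipschitzWith C γ) {η : ℝ} (hη : 0 < η) :
    ∃ h : ℝ, 0 < h ∧ ∀ s t, 0 ≤ s → s ≤ t → t ≤ 1 → t - s ≤ h →
      segCost f β (γ s) (γ t) ≤ pathCost f β γ s t + η * (t - s) := by
  have hβ0 : 0 ≤ β := by linarith
  obtain ⟨M, hM⟩ := (isCompact_Icc.image (hf.continuous.comp hγ.continuous) :
    IsCompact ((f ∘ γ) '' Icc (0 : ℝ) 1)).bddAbove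
  have hM' : ∀ t ∈ Icc (0 : ℝ) 1, f (γ t) ≤ M := fun t ht => hM (mem_image_of_mem _ ht)
  have hM0 : 0 ≤ M := (hf0 _).trans (hM' 0 (by simp))
  set A : ℝ := C * (β * (M + C) ^ (β - 1)) * (2 * C) with hA
  have hA0 : 0 ≤ A := by positivity
  refine ⟨min 1 (η / (A + 1)), by positivity, fun s t hs hst ht hts => ?_⟩
  have hC0 : (0 : ℝ) ≤ C := C.2
  have hts1 : t - s ≤ 1 := hts.trans (min_le_left _ _)
  have hts2 : A * (t - s) ≤ η := by
    have h1 := hts.trans (min_le_right _ _)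
    rw [le_div_iff₀ (by positivity)] at h1
    nlinarith
  have hts0 : 0 ≤ t - s := by linarith
  set r := (C : ℝ) * (t - s) with hr
  have hr0 : 0 ≤ r := by positivity
  set a := max (f (γ s) - r) 0 with ha
  set b := f (γ s) + r with hb
  have hab : a ≤ b := max_le (by linarith) (by have := hf0 (γ s); linarith)
  have hbM : b ≤ M + C := by
    have := hM' s ⟨hs, by linarith⟩
    have : r ≤ C := by rw [hr]; nlinarith
    linarith
  have hd : dist (γ s) (γ t) ≤ r := by
    have := hγ.dist_le_mul s t
    rwa [Real.dist_eq, abs_sub_comm, abs_of_nonneg hts0] at this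
  have hup : segCost f β (γ s) (γ t) ≤ dist (γ s) (γ t) * b ^ β := by
    refine segCost_le hf.continuous hf0 hβ0 fun τ hτ => ?_
    have h1 := dist_segment_points (γ s) (γ t) τ 0
    rw [zero_smul, add_zero, sub_zero, abs_of_nonneg hτ.1] at h1
    have h2 := (abs_le.1 (abs_sub_le_dist hf (γ s + τ • (γ t - γ s)) (γ s))).2
    have h3 : τ * dist (γ s) (γ t) ≤ 1 * dist (γ s) (γ t) :=
      mul_le_mul_of_nonneg_right hτ.2 dist_nonneg
    linarith
  have hlow : a ^ β * dist (γ s) (γ t) ≤ pathCost f β γ s t := by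
    calc _ ≤ a ^ β * ∫ τ in s..t, ‖deriv γ τ‖ :=
          mul_le_mul_of_nonneg_left (dist_le_integral_norm_deriv hγ hst) (by positivity)
      _ = ∫ τ in s..t, a ^ β * ‖deriv γ τ‖ := by rw [intervalIntegral.integral_const_mul]
      _ ≤ _ := by
        refine integral_mono_on hst ((intervalIntegrable_deriv hγ s t).norm.const_mul _)
          (intervalIntegrable_rpow_mul_norm_deriv hf.continuous hβ0 hγ s t) fun τ hτ => ?_
        refine mul_le_mul_of_nonneg_right (Real.rpow_le_rpow (le_max_right _ _) ?_ hβ0)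
          (norm_nonneg _)
        refine max_le ?_ (hf0 _)
        have h2 := (abs_le.1 (abs_sub_le_dist hf (γ s) (γ τ))).2
        have h3 := hγ.dist_le_mul s τ
        rw [Real.dist_eq, abs_sub_comm, abs_of_nonneg (by linarith [hτ.1])] at h3
        have h4 : (C : ℝ) * (τ - s) ≤ r := mul_le_mul_of_nonneg_left (by linarith [hτ.2]) hC0
        linarith
  have hdiff : b ^ β - a ^ β ≤ β * (M + C) ^ (β - 1) * (2 * r) :=
    (rpow_sub_rpow_le hβ (le_max_right _ _) hab hbM).trans
      (mul_le_mul_of_nonneg_left (by rw [hb]; linarith [le_max_left (f (γ s) - r) 0])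
        (by positivity))
  have hfin : dist (γ s) (γ t) * (b ^ β - a ^ β) ≤ η * (t - s) := by
    calc _ ≤ r * (β * (M + C) ^ (β - 1) * (2 * r)) :=
          mul_le_mul hd hdiff (sub_nonneg.2 (Real.rpow_le_rpow (le_max_right _ _) hab hβ0)) hr0
      _ = A * (t - s) * (t - s) := by rw [hA, hr]; ring
      _ ≤ _ := by gcongr
  nlinarith

lemma fdtmLength_eq_pathCost {m p : ℝ} (μ : Measure (Euc d)) (γ : ℝ → Euc d) :
    fdtmLength m p β μ γ = pathCost (dtm m p μ) β γ 0 1 := by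
  rw [fdtmLength, pathCost, integral_Icc_eq_integral_Ioc, integral_of_le zero_le_one]

lemma AdmissiblePath.exists_isChainIn {F : Set (Euc d)} {x y : Euc d} (hγ : AdmissiblePath F x y γ)
    (hF : IsClosed F) (hf : LipschitzWith 1 f) (hf0 : ∀ x, 0 ≤ f x) (hβ : 1 ≤ β) {η : ℝ}
    (hη : 0 < η) :
    ∃ n z, IsChainIn F x y n z ∧ chainCost f β n z ≤ pathCost f β γ 0 1 + η := by
  obtain ⟨⟨C, hC⟩, rfl, rfl, hstr⟩ := hγ
  have hβ0 : 0 ≤ β := by linarith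
  obtain ⟨h, hh, hh'⟩ := exists_segCost_le_pathCost_add hf hf0 hβ hC hη
  have hW : ∀ s t, pathCost f β γ s t + η * (t - s) =
      (pathCost f β γ 0 t + η * t) - (pathCost f β γ 0 s + η * s) := by
    intro s t
    have := integral_interval_sub_left
      (intervalIntegrable_rpow_mul_norm_deriv hf.continuous hβ0 hC 0 t)
      (intervalIntegrable_rpow_mul_norm_deriv hf.continuous hβ0 hC 0 s)
    simp only [pathCost] at this ⊢
    rw [← this]
    ring
  obtain ⟨n, z, hz, hz'⟩ := exists_isChainIn_of_path (β := β) (f := f)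
    (W := fun t => pathCost f β γ 0 t + η * t) hC.continuous hF hh
    (fun s t hs hst ht hts => (hh' s t hs hst ht hts).trans (hW s t).le)
    (fun s t hs hst ht hout => by
      obtain ⟨u, hu, hu'⟩ := hstr s t hs ht hout
      refine le_trans ?_ (hW s t).le
      have h1 := segCost_le_pathCost_of_straight hf.continuous hβ0 hC hst hu hu'
      have h2 : 0 ≤ η * (t - s) := mul_nonneg hη.le (by linarith)
      linarith)
  refine ⟨n, z, hz, hz'.trans ?_⟩
  simp [pathCost]

end PathCost

section Concatenation

variable {d : ℕ} {f : Euc d → ℝ} {β : ℝ} {G : Set (Euc d)} {x y z : Euc d}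

open intervalIntegral

lemma deriv_comp_two_mul_sub (γ : ℝ → Euc d) (e t : ℝ) :
    deriv (fun τ => γ (2 * τ - e)) t = (2 : ℝ) • deriv γ (2 * t - e) := by
  rw [deriv_comp_mul_left (2 : ℝ) (fun τ => γ (τ - e)) t, deriv_comp_sub_const]

lemma quasiMeasurePreserving_two_mul_sub (e : ℝ) :
    Measure.QuasiMeasurePreserving (fun t : ℝ => 2 * t - e) := by
  refine (measurePreserving_sub_right volume e).quasiMeasurePreserving.comp
    (f := fun t : ℝ => 2 * t) ⟨measurable_const_mul _, ?_⟩
  rw [Real.map_volume_mul_left two_ne_zero]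
  exact Measure.smul_absolutelyContinuous

lemma pathCost_comp_two_mul_sub (f : Euc d → ℝ) (β : ℝ) {γ δ : ℝ → Euc d} {e a b : ℝ} (hab : a ≤ b)
    (h : ∀ t ∈ Ioo a b, δ t = γ (2 * t - e)) :
    pathCost f β δ a b = pathCost f β γ (2 * a - e) (2 * b - e) := by
  rw [pathCost, pathCost, ← intervalIntegral.mul_integral_comp_mul_sub,
    ← intervalIntegral.integral_const_mul]
  refine integral_congr_ae ?_
  filter_upwards [(volume : Measure ℝ).ae_ne b] with t htb ht
  rw [uIoc_of_le hab] at ht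
  have ht' : t ∈ Ioo a b := ⟨ht.1, lt_of_le_of_ne ht.2 htb⟩
  have hd : deriv δ t = (2 : ℝ) • deriv γ (2 * t - e) := by
    rw [← deriv_comp_two_mul_sub]
    exact (Filter.eventuallyEq_of_mem (Ioo_mem_nhds ht'.1 ht'.2) h).deriv_eq
  rw [hd, h t ht', norm_smul, Real.norm_of_nonneg zero_le_two]
  ring

lemma exists_direction_comp_two_mul_sub {γ δ : ℝ → Euc d} {e a b : ℝ}
    (h : ∀ t ∈ Ioo a b, δ t = γ (2 * t - e))
    (hγ : ∃ u : Euc d, ‖u‖ = 1 ∧ ∀ᵐ t ∂(volume.restrict (Ioo (2 * a - e) (2 * b - e))),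
      deriv γ t = ‖deriv γ t‖ • u) :
    ∃ u : Euc d, ‖u‖ = 1 ∧ ∀ᵐ t ∂(volume.restrict (Ioo a b)), deriv δ t = ‖deriv δ t‖ • u := by
  obtain ⟨u, hu, hγu⟩ := hγ
  refine ⟨u, hu, ?_⟩
  rw [ae_restrict_iff' measurableSet_Ioo] at hγu ⊢
  filter_upwards [(quasiMeasurePreserving_two_mul_sub e).ae hγu] with t ht ht'
  have hd : deriv δ t = (2 : ℝ) • deriv γ (2 * t - e) := by
    rw [← deriv_comp_two_mul_sub]
    exact (Filter.eventuallyEq_of_mem (Ioo_mem_nhds ht'.1 ht'.2) h).deriv_eq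
  rw [hd, norm_smul, Real.norm_of_nonneg zero_le_two, mul_smul,
    ← ht ⟨by linarith [ht'.1], by linarith [ht'.2]⟩]

lemma AdmissiblePath.exists_concat (hf : Continuous f) (hβ : 0 ≤ β) (hz : z ∈ G) {γ₁ γ₂ : ℝ → Euc d}
    (h₁ : AdmissiblePath G x z γ₁) (h₂ : AdmissiblePath G z y γ₂) :
    ∃ γ, AdmissiblePath G x y γ ∧
      pathCost f β γ 0 1 = pathCost f β γ₁ 0 1 + pathCost f β γ₂ 0 1 := by
  obtain ⟨⟨C₁, hC₁⟩, rfl, h₁z, hs₁⟩ := h₁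
  obtain ⟨⟨C₂, hC₂⟩, h₂z, rfl, hs₂⟩ := h₂
  set γ : ℝ → Euc d := fun t => γ₁ (2 * min t 2⁻¹) + (γ₂ (2 * max t 2⁻¹ - 1) - z) with hγ
  have hleft : ∀ t ≤ (2⁻¹ : ℝ), γ t = γ₁ (2 * t - 0) := by
    intro t ht
    simp [hγ, min_eq_left ht, max_eq_right ht, h₂z]
  have hright : ∀ t : ℝ, 2⁻¹ ≤ t → γ t = γ₂ (2 * t - 1) := by
    intro t ht
    simp [hγ, min_eq_right ht, max_eq_left ht, h₁z]
  have hL : LipschitzWith (C₁ * 2 + C₂ * 2) γ := by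
    refine LipschitzWith.add ?_ ?_
    · refine hC₁.comp (LipschitzWith.of_dist_le_mul fun s t => ?_)
      have := (LipschitzWith.id.min_const (2⁻¹ : ℝ)).dist_le_mul s t
      simp only [id, Real.dist_eq, NNReal.coe_one, one_mul] at this
      rw [Real.dist_eq, ← mul_sub, abs_mul, abs_two, Real.dist_eq]
      simpa using this
    · refine (LipschitzWith.of_dist_le_mul fun s t => ?_ :
        LipschitzWith (C₂ * 2) fun t => γ₂ (2 * max t 2⁻¹ - 1) - z)
      rw [dist_sub_right]
      refine (hC₂.dist_le_mul _ _).trans ?_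
      have := (LipschitzWith.id.max_const (2⁻¹ : ℝ)).dist_le_mul s t
      simp only [id, Real.dist_eq, NNReal.coe_one, one_mul] at this
      rw [dist_sub_right, Real.dist_eq, ← mul_sub, abs_mul, abs_two, Real.dist_eq]
      push_cast
      rw [mul_assoc]
      gcongr
  refine ⟨γ, ⟨⟨_, hL⟩, ?_, ?_, ?_⟩, ?_⟩
  · rw [hleft 0 (by norm_num)]; norm_num
  · rw [hright 1 (by norm_num)]; norm_num
  · intro a b ha hb hout
    rcases le_or_gt b 2⁻¹ with hb' | hb'
    · refine exists_direction_comp_two_mul_sub (e := 0) (fun t ht => hleft t (ht.2.le.trans hb'))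
        (hs₁ _ _ (by linarith) (by linarith) fun t ht => ?_)
      have h3 := hleft (t / 2) (by linarith [ht.2])
      rw [show 2 * (t / 2) - 0 = t by ring] at h3
      rw [← h3]
      exact hout _ ⟨by linarith [ht.1], by linarith [ht.2]⟩
    rcases le_or_gt 2⁻¹ a with ha' | ha'
    · refine exists_direction_comp_two_mul_sub (e := 1) (fun t ht => hright t (ha'.trans ht.1.le))
        (hs₂ _ _ (by linarith) (by linarith) fun t ht => ?_)
      have h3 := hright ((t + 1) / 2) (by linarith [ht.1])
      rw [show 2 * ((t + 1) / 2) - 1 = t by ring] at h3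
      rw [← h3]
      exact hout _ ⟨by linarith [ht.1], by linarith [ht.2]⟩
    · refine absurd ?_ (hout 2⁻¹ ⟨ha', hb'⟩)
      rw [hright _ le_rfl]
      norm_num [h₂z, hz]
  · have hi := intervalIntegrable_rpow_mul_norm_deriv hf hβ hL
    rw [pathCost, ← integral_add_adjacent_intervals (hi 0 2⁻¹) (hi 2⁻¹ 1)]
    have e₁ : pathCost f β γ 0 2⁻¹ = pathCost f β γ₁ 0 1 :=
      (pathCost_comp_two_mul_sub f β (by norm_num) fun t ht => hleft t ht.2.le).trans (by norm_num)
    have e₂ : pathCost f β γ 2⁻¹ 1 = pathCost f β γ₂ 0 1 :=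
      (pathCost_comp_two_mul_sub f β (by norm_num) fun t ht => hright t ht.1.le).trans
        (by norm_num)
    rw [← e₁, ← e₂]
    rfl

lemma exists_admissiblePath_segment [Nontrivial (Euc d)] (f : Euc d → ℝ) (β : ℝ) (G : Set (Euc d))
    (x y : Euc d) :
    ∃ γ, AdmissiblePath G x y γ ∧ pathCost f β γ 0 1 = segCost f β x y := by
  have hd : ∀ t : ℝ, deriv (fun t : ℝ => x + t • (y - x)) t = y - x := fun t => by
    simpa using (((hasDerivAt_id t).smul_const (y - x)).const_add x).deriv
  refine ⟨fun t => x + t • (y - x), ⟨⟨‖y - x‖₊, LipschitzWith.of_dist_le_mul fun s t => ?_⟩,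
    by simp, by simp, fun a b _ _ _ => ?_⟩, ?_⟩
  · rw [dist_segment_points, dist_comm x y, dist_eq_norm y x, coe_nnnorm, Real.dist_eq, mul_comm]
  · simp_rw [hd]
    rcases eq_or_ne (y - x) 0 with h | h
    · obtain ⟨u, hu⟩ := exists_norm_eq (Euc d) zero_le_one
      exact ⟨u, hu, by simp [h]⟩
    · refine ⟨‖y - x‖⁻¹ • (y - x), norm_smul_inv_norm h, Filter.Eventually.of_forall fun _ => ?_⟩
      rw [smul_smul, mul_inv_cancel₀ (norm_ne_zero_iff.2 h), one_smul]
  · simp only [pathCost, hd, segCost]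
    rw [intervalIntegral.integral_mul_const, mul_comm, dist_comm x y, dist_eq_norm]

lemma pathCost_nonneg (hf0 : ∀ x, 0 ≤ f x) (γ : ℝ → Euc d) : 0 ≤ pathCost f β γ 0 1 :=
  integral_nonneg zero_le_one fun _ _ =>
    mul_nonneg (Real.rpow_nonneg (hf0 _) _) (norm_nonneg _)

end Concatenation

section FermatDistance

variable {d : ℕ} {m p β : ℝ} {μ : Measure (Euc d)} {G : Set (Euc d)} {x y z : Euc d}

lemma fdtm_le_pathCost (hf0 : ∀ x, 0 ≤ dtm m p μ x) {γ : ℝ → Euc d} (hγ : AdmissiblePath G x y γ) :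
    fdtm m p β μ G x y ≤ pathCost (dtm m p μ) β γ 0 1 := by
  refine csInf_le ⟨0, ?_⟩ ⟨γ, hγ, (fdtmLength_eq_pathCost μ γ).symm⟩
  rintro _ ⟨γ', -, rfl⟩
  rw [fdtmLength_eq_pathCost]
  exact pathCost_nonneg hf0 γ'

lemma le_fdtm [Nontrivial (Euc d)] {c : ℝ}
    (h : ∀ γ, AdmissiblePath G x y γ → c ≤ pathCost (dtm m p μ) β γ 0 1) :
    c ≤ fdtm m p β μ G x y := by
  obtain ⟨γ, hγ, -⟩ := exists_admissiblePath_segment (dtm m p μ) β G x y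
  refine le_csInf ⟨_, γ, hγ, rfl⟩ ?_
  rintro _ ⟨γ', hγ', rfl⟩
  rw [fdtmLength_eq_pathCost]
  exact h γ' hγ'

lemma fdtm_le_segCost [Nontrivial (Euc d)] (hf0 : ∀ x, 0 ≤ dtm m p μ x) (x y : Euc d) :
    fdtm m p β μ G x y ≤ segCost (dtm m p μ) β x y := by
  obtain ⟨γ, hγ, h⟩ := exists_admissiblePath_segment (dtm m p μ) β G x y
  exact h ▸ fdtm_le_pathCost hf0 hγ

lemma fdtm_triangle [Nontrivial (Euc d)] (hf0 : ∀ x, 0 ≤ dtm m p μ x)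
    (hf : Continuous (dtm m p μ)) (hβ : 0 ≤ β) (hz : z ∈ G) :
    fdtm m p β μ G x y ≤ fdtm m p β μ G x z + fdtm m p β μ G z y := by
  rw [← sub_le_iff_le_add']
  refine le_fdtm fun γ₂ h₂ => ?_
  rw [sub_le_comm]
  refine le_fdtm fun γ₁ h₁ => ?_
  obtain ⟨γ, hγ, h⟩ := h₁.exists_concat hf hβ hz h₂
  have := fdtm_le_pathCost (β := β) hf0 hγ
  linarith

lemma AdmissiblePath.mono {F : Set (Euc d)} (hFG : F ⊆ G) {γ : ℝ → Euc d}
    (hγ : AdmissiblePath F x y γ) : AdmissiblePath G x y γ :=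
  ⟨hγ.1, hγ.2.1, hγ.2.2.1, fun a b ha hb h =>
    hγ.2.2.2 a b ha hb fun t ht htF => h t ht (hFG htF)⟩

end FermatDistance

section Constants

variable {m β : ℝ}

lemma packingConst_le_fdtmConst (hm0 : 0 < m) (hm : m < 1) (hβ : 1 ≤ β) :
    1156 / m ^ 2 * (1248 / m) ^ β ≤ fdtmConst m β := by
  have hβ0 : 0 ≤ β := by linarith
  have h1 : (32 / m) ^ (β + 1) ≤ (1 + 32 / m) ^ (β + 1) := by
    gcongr
    linarith
  have h2 : (32 / m) ^ (β + 1) = (32 / m) ^ β * (32 / m) := by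
    rw [Real.rpow_add_one (by positivity)]
  have h3 : m ^ (2 + β) = m ^ 2 * m ^ β := by
    rw [Real.rpow_add hm0, Real.rpow_two]
  have h4 : (1248 / m) ^ β ≤ 165 ^ β / m ^ β * (32 / m) ^ β := by
    rw [← Real.div_rpow (by norm_num) hm0.le, ← Real.mul_rpow (by positivity) (by positivity)]
    have h5 : (1 : ℝ) ≤ 32 / m := by rw [le_div_iff₀ hm0]; linarith
    gcongr
    rw [div_mul_div_comm, div_le_div_iff₀ hm0 (by positivity)]
    nlinarith
  calc 1156 / m ^ 2 * (1248 / m) ^ β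
      ≤ 2304 / m ^ 2 * (165 ^ β / m ^ β * (32 / m) ^ β) := by gcongr; norm_num
    _ = 2 * ((0 + 1152 * (165 : ℝ) ^ β) / (m ^ 2 * m ^ β)) * ((32 / m) ^ β * (32 / m)) /
          (32 / m) := by field_simp; ring
    _ ≤ 2 * ((16 * (5 : ℝ) ^ β + 1152 * (165 : ℝ) ^ β) / (m ^ 2 * m ^ β)) *
          (1 + 32 / m) ^ (β + 1) / (32 / m) := by
        rw [← h2]
        gcongr
        positivity
    _ = fdtmConst m β := by rw [fdtmConst, h3, add_sub_cancel_left]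

lemma one_le_packingConst (hm0 : 0 < m) (hm : m < 1) (hβ : 1 ≤ β) :
    1 ≤ 1156 / m ^ 2 * (1248 / m) ^ β := by
  have h1 : 1 ≤ 1156 / m ^ 2 := by rw [le_div_iff₀ (by positivity)]; nlinarith
  have h2 : 1 ≤ (1248 / m) ^ β :=
    Real.one_le_rpow (by rw [le_div_iff₀ hm0]; linarith) (by linarith)
  nlinarith

lemma perturbation_error_le {ε Δ S A lam : ℝ} (hβ : 1 ≤ β) (hε : 0 < ε) (hΔ : 0 < Δ)
    (hεΔ : ε ≤ Δ / (25 * β)) (hS0 : 0 ≤ S) (hS : S ≤ A * Δ) (hA : 1 ≤ A) (hlam : A ≤ lam) :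
    (2 * √(ε * Δ / β) + ε) * (β * Δ ^ (β - 1)) * S +
      2 * ε * Δ ^ β * (2 * S / √(ε * Δ / β) + 2) ≤
    10 * √β * lam * Δ ^ (β + 1 / 2) * √ε := by
  have hβ0 : 0 < β := by linarith
  set L := √(ε * Δ / β) with hLdef
  have hL : 0 < L := Real.sqrt_pos.2 (by positivity)
  have hL2 : β * L ^ 2 = ε * Δ := by rw [hLdef, Real.sq_sqrt (by positivity)]; field_simp
  have hεL : ε ≤ L / 5 := by
    rw [le_div_iff₀ (by positivity)] at hεΔ
    refine (sq_le_sq₀ hε.le (by positivity)).1 ?_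
    have h1 : β * ε ^ 2 * 25 ≤ β * L ^ 2 := by rw [hL2]; nlinarith
    have h2 : β * (ε ^ 2 * 25) ≤ β * L ^ 2 := by linarith
    have := le_of_mul_le_mul_left h2 hβ0
    nlinarith
  have hpow : Δ ^ (β - 1) * Δ = Δ ^ β := by
    rw [← Real.rpow_add_one hΔ.ne', sub_add_cancel]
  have hT : √β * Δ ^ (β + 1 / 2) * √ε = β * Δ ^ β * L := by
    rw [hLdef, Real.sqrt_div' _ hβ0.le, Real.sqrt_mul hε.le, Real.rpow_add hΔ,
      ← Real.sqrt_eq_rpow]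
    have : β / √β = √β := Real.div_sqrt
    calc _ = √β * (Δ ^ β * √Δ * √ε) := by ring
      _ = β / √β * (Δ ^ β * √Δ * √ε) := by rw [this]
      _ = _ := by ring
  set T := β * Δ ^ β * L with hTdef
  have hT0 : 0 < T := by positivity
  have t1 : (2 * L + ε) * (β * Δ ^ (β - 1)) * S ≤ 2.2 * A * T := by
    calc _ ≤ (2 * L + L / 5) * (β * Δ ^ (β - 1)) * (A * Δ) := by gcongr
      _ = 2.2 * A * (β * (Δ ^ (β - 1) * Δ) * L) := by ring
      _ = _ := by rw [hpow]
  have t2 : 2 * ε * Δ ^ β * (2 * S / L) ≤ 4 * A * T := by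
    calc _ ≤ 2 * ε * Δ ^ β * (2 * (A * Δ) / L) := by gcongr
      _ = 4 * A * Δ ^ β * (ε * Δ) / L := by ring
      _ = 4 * A * Δ ^ β * (β * L ^ 2) / L := by rw [hL2]
      _ = _ := by rw [hTdef]; field_simp
  have t3 : 2 * ε * Δ ^ β * 2 ≤ 0.8 * A * T := by
    calc _ ≤ 2 * (L / 5) * Δ ^ β * 2 := by gcongr
      _ = 0.8 * 1 * (1 * Δ ^ β * L) := by ring
      _ ≤ 0.8 * A * (β * Δ ^ β * L) := by gcongr
  calc _ ≤ 7 * A * T := by linarith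
    _ ≤ 10 * lam * T := by gcongr; norm_num
    _ = _ := by rw [← hT]; ring

end Constants

section Stability

variable {d : ℕ}

lemma bddAbove_range_infDist {K F G : Set (Euc d)} (hK : Bornology.IsBounded K) (hFK : F ⊆ K)
    (hGK : G ⊆ K) (hG : G.Nonempty) :
    BddAbove (range fun z => ⨆ (_ : z ∈ F), infDist z G) := by
  refine ⟨diam K, ?_⟩
  rintro _ ⟨z, rfl⟩
  refine Real.iSup_le (fun hz => ?_) diam_nonneg
  obtain ⟨g, hg⟩ := hG
  exact (infDist_le_dist_of_mem hg).trans (dist_le_diam_of_mem hK (hFK hz) (hGK hg))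

lemma fdtm_le_pathCost_add {m p β : ℝ} (hm : m ∈ Ioo (0 : ℝ) 1) (hp : 1 ≤ p) (hβ : 1 ≤ β)
    [Nontrivial (Euc d)] {K : Set (Euc d)} (hKb : Bornology.IsBounded K) (hKconv : Convex ℝ K)
    (μ : Measure (Euc d)) [IsProbabilityMeasure μ] (hsupp : measSupport μ ⊆ K)
    {F G : Set (Euc d)} (hFK : F ⊆ K) (hF : IsClosed F) (hGK : G ⊆ K) (hG : IsClosed G)
    (hGne : G.Nonempty) {ε : ℝ} (hε : 0 < ε) (hεF : ∀ z ∈ F, infDist z G ≤ ε)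
    (hεK : ε ≤ diam K / (25 * β)) {x y : Euc d} (hx : x ∈ K) (hy : y ∈ K) {γ : ℝ → Euc d}
    (hγ : AdmissiblePath F x y γ) {η : ℝ} (hη : 0 < η) :
    fdtm m p β μ G x y ≤ pathCost (dtm m p μ) β γ 0 1 + η +
      10 * √β * fdtmConst m β * diam K ^ (β + 1 / 2) * √ε := by
  obtain ⟨hm0, hm1⟩ := hm
  have hβ0 : 0 < β := by linarith
  have hΔ : 0 < diam K := by
    by_contra! h
    have : diam K / (25 * β) ≤ 0 := div_nonpos_of_nonpos_of_nonneg h (by positivity)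
    linarith
  have hf : LipschitzWith 1 (dtm m p μ) := dtm_lipschitz hm0 hm1 hp
  have hf0 : ∀ x, 0 ≤ dtm m p μ x := dtm_nonneg hm0 hm1 hp
  have hfK : ∀ x ∈ K, dtm m p μ x ≤ diam K := fun x hx => dtm_le_diam hm0 hm1 hp hKb hsupp hx
  have hpack : PackingBound (dtm m p μ) m := fun s z r hs hsep hz =>
    card_mul_lt_of_dtm_lt hm0 hm1 hp s hs z hsep hz
  obtain ⟨n₀, z₀, hz₀, hcost₀⟩ := hγ.exists_isChainIn hF hf hf0 hβ hη
  obtain ⟨n, z, ⟨hzx, hzy, hzF⟩, hcost, hgeo⟩ :=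
    hz₀.exists_isGeodesicChain (f := dtm m p μ) (β := β)
  have hzK : ∀ k ≤ n, z k ∈ K := by
    intro k hk
    rcases k.eq_zero_or_pos with rfl | hk0
    · rwa [hzx]
    rcases hk.eq_or_lt with rfl | hkn
    · rwa [hzy]
    · exact hFK (hzF k hk0 hkn)
  have hsum := sum_dist_le_of_isGeodesicChain hf hf0 hβ0.le hm0 hm1 hpack hgeo hΔ fun k hk =>
    max_le (dist_le_diam_of_mem hKb (hzK k hk.le) (hzK (k + 1) hk)) (hfK _ (hzK k hk.le))
  choose g hgG hg using fun v => hG.exists_infDist_eq_dist hGne v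
  set q : ℕ → Euc d := fun k => if 0 < k ∧ k < n then g (z k) else z k with hq
  have hq0 : q 0 = x := by simp [hq, hzx]
  have hqn : q n = y := by simp [hq, hzy]
  have key := cost_le_of_nearby_chain hf hf0 hβ hKconv hfK (fun x y => fdtm_le_segCost hf0 x y)
    (fun x y w hw => fdtm_triangle (G := G) hf0 hf.continuous hβ0.le hw) (z := z) (q := q) (ε := ε)
    (L := √(ε * diam K / β)) hzK
    (fun k hk => by
      simp only [hq]
      split_ifs with h
      exacts [hGK (hgG _), hzK k hk])
    (fun k hk0 hkn => by
      simp only [hq, if_pos (And.intro hk0 hkn)]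
      exact hgG _)
    (fun k hk => by
      simp only [hq]
      split_ifs with h
      · rw [dist_comm, ← hg]
        exact hεF _ (hzF k h.1 h.2)
      · rw [dist_self]
        exact hε.le)
    (Real.sqrt_pos.2 (by positivity))
  rw [hq0, hqn] at key
  have herr := perturbation_error_le hβ hε hΔ hεK
    (Finset.sum_nonneg fun _ _ => dist_nonneg) hsum (one_le_packingConst hm0 hm1 hβ)
    (packingConst_le_fdtmConst hm0 hm1 hβ)
  have hc : ∑ k ∈ Finset.range n, segCost (dtm m p μ) β (z k) (z (k + 1)) ≤
      pathCost (dtm m p μ) β γ 0 1 + η := hcost.trans hcost₀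
  linarith

end Stability

theorem fdtm_stability_domain_one_sided {d : ℕ} (m p β : ℝ) (hm : m ∈ Set.Ioo (0 : ℝ) 1)
    (hp : 1 ≤ p) (hβ : 1 ≤ β) (K : Set (Euc d)) (hKc : IsCompact K) (hKconv : Convex ℝ K)
    (μ : Measure (Euc d)) [IsProbabilityMeasure μ] (hsupp : measSupport μ ⊆ K)
    (F G : Set (Euc d)) (hFK : F ⊆ K) (hF : IsClosed F) (hFne : F.Nonempty)
    (hGK : G ⊆ K) (hG : IsClosed G) (hGne : G.Nonempty)
    (hclose : (⨆ z ∈ F, infDist z G) ≤ diam K / (25 * β))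
    (x y : Euc d) (hx : x ∈ K) (hy : y ∈ K) :
    fdtm m p β μ G x y ≤ fdtm m p β μ F x y +
      10 * Real.sqrt β * fdtmConst m β * diam K ^ (β + 1 / 2) *
        Real.sqrt (⨆ z ∈ F, infDist z G) := by
  set ε := ⨆ z ∈ F, infDist z G with hεdef
  have hεF : ∀ z ∈ F, infDist z G ≤ ε := fun z hz =>
    (le_ciSup (f := fun _ : z ∈ F => infDist z G) (finite_range _).bddAbove hz).trans
      (le_ciSup (bddAbove_range_infDist hKc.isBounded hFK hGK hGne) z)
  have hε0 : 0 ≤ ε := Real.iSup_nonneg fun z => Real.iSup_nonneg fun _ => infDist_nonneg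
  have hf0 : ∀ x, 0 ≤ dtm m p μ x := dtm_nonneg hm.1 hm.2 hp
  rcases subsingleton_or_nontrivial (Euc d) with hd | hd
  · have hempty : ∀ H : Set (Euc d), fdtm m p β μ H x y ≤ 0 ∧ 0 ≤ fdtm m p β μ H x y := by
      intro H
      have hL : ∀ γ : ℝ → Euc d, fdtmLength m p β μ γ = 0 := fun γ => by
        simp [fdtmLength, Subsingleton.elim (deriv γ _) 0]
      refine ⟨Real.sInf_nonpos ?_, Real.sInf_nonneg ?_⟩ <;>
      · rintro _ ⟨γ, -, rfl⟩
        rw [hL]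
    have hc : 0 ≤ fdtmConst m β :=
      zero_le_one.trans ((one_le_packingConst hm.1 hm.2 hβ).trans
        (packingConst_le_fdtmConst hm.1 hm.2 hβ))
    have := diam_nonneg (s := K)
    have h1 : 0 ≤ 10 * √β * fdtmConst m β * diam K ^ (β + 1 / 2) * √ε := by positivity
    linarith [(hempty G).1, (hempty F).2]
  rcases hε0.eq_or_lt with h0 | hpos
  · rw [← h0, Real.sqrt_zero, mul_zero, add_zero]
    have hFG : F ⊆ G := fun z hz =>
      (hG.mem_iff_infDist_zero hGne).2 (le_antisymm ((hεF z hz).trans h0.ge) infDist_nonneg)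
    exact le_fdtm fun γ hγ => fdtm_le_pathCost hf0 (hγ.mono hFG)
  · rw [← sub_le_iff_le_add]
    refine le_fdtm fun γ hγ => ?_
    rw [sub_le_iff_le_add]
    refine le_of_forall_pos_le_add fun η hη => ?_
    have := fdtm_le_pathCost_add hm hp hβ hKc.isBounded hKconv μ hsupp hFK hF hGK hG hGne hpos hεF
      hclose hx hy hγ hη
    linarith

end
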